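/- arXiv:2211.16873 — 6 statements merged into one kernel-verified Lean document; each statement's English description precedes it below -/
import Mathlib

section
/- For every real p with 1 ≤ p ≤ 2, the critical determinant of the region D_p = {(x,y) ∈ ℝ² : |x|^p + |y|^p < 1} equals 4^{−1/p}·(1+τ_p)/(1−τ_p), where τ_p is the unique τ ∈ [0,1) with 2(1−τ)^p = 1 + τ^p. -/
open Real Pointwise

noncomputable section

/-- The open ball `D_p = {(x,y) : |x|^p + |y|^p < 1}`. -/
def Dp (p : ℝ) : Set (ℝ × ℝ) := {xy | |xy.1| ^ p + |xy.2| ^ p < 1}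

/-- The closed ball `D̄_p = {(x,y) : |x|^p + |y|^p ≤ 1}`. -/
def closedDp (p : ℝ) : Set (ℝ × ℝ) := {xy | |xy.1| ^ p + |xy.2| ^ p ≤ 1}

/-- The boundary curve `|x|^p + |y|^p = 1`. -/
def Cp (p : ℝ) : Set (ℝ × ℝ) := {xy | |xy.1| ^ p + |xy.2| ^ p = 1}

/-- The lattice (ℤ-span) generated by two vectors `v1, v2` in `ℝ²`. -/
def latticeSet (v1 v2 : ℝ × ℝ) : Set (ℝ × ℝ) :=
  {x | ∃ m n : ℤ, x = (m : ℝ) • v1 + (n : ℝ) • v2}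

/-- Determinant of the pair of basis vectors; the covolume is `|det2 v1 v2|`. -/
def det2 (v1 v2 : ℝ × ℝ) : ℝ := v1.1 * v2.2 - v1.2 * v2.1

/-- A lattice is admissible for `S` if it meets `S` at most in the origin. -/
def IsAdmissible (v1 v2 : ℝ × ℝ) (S : Set (ℝ × ℝ)) : Prop :=
  latticeSet v1 v2 ∩ S ⊆ {0}

/-- The critical determinant of `S`: infimum of covolumes of admissible full-rank lattices. -/
def critDet (S : Set (ℝ × ℝ)) : ℝ :=
  sInf {d | ∃ v1 v2 : ℝ × ℝ, det2 v1 v2 ≠ 0 ∧ IsAdmissible v1 v2 S ∧ d = |det2 v1 v2|}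

/-- The translates of the open ball `D_p` by the lattice points are pairwise disjoint. -/
def TranslatesDisjoint (p : ℝ) (v1 v2 : ℝ × ℝ) : Prop :=
  ∀ b1 ∈ latticeSet v1 v2, ∀ b2 ∈ latticeSet v1 v2, b1 ≠ b2 →
    Disjoint ((fun x => x + b1) '' Dp p) ((fun x => x + b2) '' Dp p)

/-- A packing lattice of the closed ball `D̄_p`: a full-rank lattice whose translates
of the open ball `D_p` are pairwise disjoint. -/
def IsPackingLattice (p : ℝ) (v1 v2 : ℝ × ℝ) : Prop :=
  det2 v1 v2 ≠ 0 ∧ TranslatesDisjoint p v1 v2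

/-- Integral representation of `x ^ q`, `0 < q < 1`, transfers nonnegativity from the kernels
`x / (x + t)` to the powers. -/
lemma sum_mul_rpow_nonneg {ι : Type*} (S : Finset ι) (c l : ι → ℝ) (hl : ∀ i, 0 < l i)
    (H : ∀ t : ℝ, 0 < t → 0 ≤ ∑ i ∈ S, c i * (l i / (l i + t))) {q : ℝ} (hq : q ∈ Set.Ioo 0 1) :
    0 ≤ ∑ i ∈ S, c i * l i ^ q := by
  obtain ⟨μ, hμ⟩ := Real.exists_measure_rpow_eq_integral_rpowIntegrand₀₁ hq
  have hsum : ∑ i ∈ S, c i * l i ^ q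
      = ∫ t in Set.Ioi 0, ∑ i ∈ S, c i * Real.rpowIntegrand₀₁ q t (l i) ∂μ := by
    rw [MeasureTheory.integral_finsetSum]
    · refine Finset.sum_congr rfl fun i _ => ?_
      rw [MeasureTheory.integral_const_mul, ← (hμ (l i) (hl i).le).2]
    · exact fun i _ => ((hμ (l i) (hl i).le).1).const_mul _
  rw [hsum]
  refine MeasureTheory.setIntegral_nonneg measurableSet_Ioi fun t ht => ?_
  have ht' : 0 < t := ht
  have : ∑ i ∈ S, c i * Real.rpowIntegrand₀₁ q t (l i)
      = t ^ q / t * ∑ i ∈ S, c i * (l i / (l i + t)) := by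
    rw [Finset.mul_sum]
    refine Finset.sum_congr rfl fun i _ => ?_
    have := hl i
    rw [Real.rpowIntegrand₀₁]
    field_simp
    ring
  rw [this]
  exact mul_nonneg (by positivity) (H t ht')

lemma kernel_coeff_four_nonneg {r s : ℝ} (hr : 0 < r) (hs : 0 < s)
    (h : 1 ≤ r + s + 2 * (r * s)) :
    0 ≤ -1 + s ^ 2 + 4 * r * s + 6 * r * s ^ 2 + r ^ 2 + 6 * r ^ 2 * s + 6 * r ^ 2 * s ^ 2 := by
  have h1 : 0 < r * s := mul_pos hr hs
  nlinarith [mul_nonneg (sub_nonneg.2 h) (by positivity : 0 ≤ r + s + 1),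
    mul_pos h1 hr, mul_pos h1 hs, mul_pos h1 h1]

lemma kernel_coeff_three_nonneg {r s : ℝ} (hr : 0 < r) (hs : 0 < s)
    (h : 1 ≤ r + s + 2 * (r * s)) :
    0 ≤ -1 - s + s ^ 2 + s ^ 3 - r + 9 * r * s ^ 2 + 8 * r * s ^ 3 + r ^ 2 + 9 * r ^ 2 * s
      + 24 * r ^ 2 * s ^ 2 + 18 * r ^ 2 * s ^ 3 + r ^ 3 + 8 * r ^ 3 * s + 18 * r ^ 3 * s ^ 2
      + 12 * r ^ 3 * s ^ 3 := by
  have h1 : 0 < r * s := mul_pos hr hs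
  have h2 : 1 / 3 ≤ r + s := by nlinarith [sq_nonneg (r - s)]
  have h3 : 0 ≤ -2 + (r + s) + 3 * (r + s) ^ 2 + 4 * (r * s) := by nlinarith
  nlinarith [mul_nonneg (sub_nonneg.2 h) (by positivity : 0 ≤ (r + s + 1) ^ 2),
    mul_nonneg h1.le h3, mul_pos (mul_pos h1 h1) hr, mul_pos (mul_pos h1 h1) hs,
    mul_pos (mul_pos h1 h1) h1]

lemma kernel_numerator_eq (r s t : ℝ) :
    -(r * s * (r * r * s * s + t * (r + s + r * s)))
        * ((r * s * (1 + r) + t) * (r * s * (1 + s) + t))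
        * ((r * (1 + r) * (1 + s) + t) * (s * (1 + r) * (1 + s) + t))
        * (((1 + r) * (1 + r) * (1 + s) + t) * ((1 + r) * (1 + s) * (1 + s) + t))
      + r * s * (-(r * s * (1 + r) * (1 + s)) + t * (r + s + r * s))
        * ((r * r * s + t) * (r * s * s + t))
        * ((r * (1 + r) * (1 + s) + t) * (s * (1 + r) * (1 + s) + t))
        * (((1 + r) * (1 + r) * (1 + s) + t) * ((1 + r) * (1 + s) * (1 + s) + t))
      + (1 + r) * (1 + s) * (r * s * (1 + r) * (1 + s) + t * (r * s - 1))
        * ((r * r * s + t) * (r * s * s + t))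
        * ((r * s * (1 + r) + t) * (r * s * (1 + s) + t))
        * (((1 + r) * (1 + r) * (1 + s) + t) * ((1 + r) * (1 + s) * (1 + s) + t))
      + (1 + r) * (1 + s) * ((1 + r) ^ 2 * (1 + s) ^ 2 + t * (1 - r * s))
        * ((r * r * s + t) * (r * s * s + t))
        * ((r * s * (1 + r) + t) * (r * s * (1 + s) + t))
        * ((r * (1 + r) * (1 + s) + t) * (s * (1 + r) * (1 + s) + t))
    = t ^ 2 * (1 + r + s) * (
      (r * s * (1 + r) * (1 + s)) ^ 3
        * (1 + 3*s + 3*s^2 + s^3 + 3*r + 6*r*s + 5*r*s^2 + 2*r*s^3 + 3*r^2 + 5*r^2*s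
          + 2*r^2*s^2 + r^3 + 2*r^3*s)
      + t * ((r * s * (1 + r) * (1 + s)) ^ 2 * (1 + r + s)
        * (3 + 5*s + 3*s^2 + s^3 + 5*r + 16*r*s + 11*r*s^2 + 2*r*s^3 + 3*r^2 + 11*r^2*s
          + 8*r^2*s^2 + r^3 + 2*r^3*s))
      + t ^ 2 * (r * s * (1 + r) * (1 + s)
        * (2*s + 6*s^2 + 6*s^3 + 2*s^4 + 2*r + 20*r*s + 40*r*s^2 + 30*r*s^3 + 8*r*s^4 + 6*r^2
          + 40*r^2*s + 72*r^2*s^2 + 46*r^2*s^3 + 8*r^2*s^4 + 6*r^3 + 30*r^3*s + 46*r^3*s^2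
          + 20*r^3*s^3 + 2*r^4 + 8*r^4*s + 8*r^4*s^2))
      + t ^ 3 * ((1 + r + s)
        * (-1 - s + s ^ 2 + s ^ 3 - r + 9 * r * s ^ 2 + 8 * r * s ^ 3 + r ^ 2 + 9 * r ^ 2 * s
          + 24 * r ^ 2 * s ^ 2 + 18 * r ^ 2 * s ^ 3 + r ^ 3 + 8 * r ^ 3 * s + 18 * r ^ 3 * s ^ 2
          + 12 * r ^ 3 * s ^ 3))
      + t ^ 4
        * (-1 + s ^ 2 + 4 * r * s + 6 * r * s ^ 2 + r ^ 2 + 6 * r ^ 2 * s + 6 * r ^ 2 * s ^ 2)) := by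
  ring

lemma rational_kernel_nonneg {r s t : ℝ} (hr : 0 < r) (hrs : r ≤ s) (ht : 0 < t)
    (h : 1 ≤ r + s + 2 * (r * s)) :
    0 ≤ (r * (1 + s) * (r * r * s / (r * r * s + t))
        - s * (1 + r) * (r * s * s / (r * s * s + t)))
      + ((r + (1 + r) * (1 + s)) * (r * s * (1 + s) / (r * s * (1 + s) + t))
        - (s + (1 + r) * (1 + s)) * (r * s * (1 + r) / (r * s * (1 + r) + t)))
      + ((1 + s - r * s) * (r * (1 + r) * (1 + s) / (r * (1 + r) * (1 + s) + t))
        - (1 + r - r * s) * (s * (1 + r) * (1 + s) / (s * (1 + r) * (1 + s) + t)))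
      + (s * (1 + r) * ((1 + r) * (1 + r) * (1 + s) / ((1 + r) * (1 + r) * (1 + s) + t))
        - r * (1 + s) * ((1 + r) * (1 + s) * (1 + s) / ((1 + r) * (1 + s) * (1 + s) + t))) := by
  have hs : 0 < s := hr.trans_le hrs
  have e1 : r * (1 + s) * (r * r * s / (r * r * s + t))
        - s * (1 + r) * (r * s * s / (r * s * s + t))
      = (s - r) * (-(r * s * (r * r * s * s + t * (r + s + r * s)))
        / ((r * r * s + t) * (r * s * s + t))) := by
    field_simp; ring
  have e2 : (r + (1 + r) * (1 + s)) * (r * s * (1 + s) / (r * s * (1 + s) + t))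
      - (s + (1 + r) * (1 + s)) * (r * s * (1 + r) / (r * s * (1 + r) + t))
      = (s - r) * (r * s * (-(r * s * (1 + r) * (1 + s)) + t * (r + s + r * s))
        / ((r * s * (1 + r) + t) * (r * s * (1 + s) + t))) := by
    field_simp; ring
  have e3 : (1 + s - r * s) * (r * (1 + r) * (1 + s) / (r * (1 + r) * (1 + s) + t))
      - (1 + r - r * s) * (s * (1 + r) * (1 + s) / (s * (1 + r) * (1 + s) + t))
      = (s - r) * ((1 + r) * (1 + s) * (r * s * (1 + r) * (1 + s) + t * (r * s - 1))
        / ((r * (1 + r) * (1 + s) + t) * (s * (1 + r) * (1 + s) + t))) := by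
    field_simp; ring
  have e4 : s * (1 + r) * ((1 + r) * (1 + r) * (1 + s) / ((1 + r) * (1 + r) * (1 + s) + t))
      - r * (1 + s) * ((1 + r) * (1 + s) * (1 + s) / ((1 + r) * (1 + s) * (1 + s) + t))
      = (s - r) * ((1 + r) * (1 + s) * ((1 + r) ^ 2 * (1 + s) ^ 2 + t * (1 - r * s))
        / (((1 + r) * (1 + r) * (1 + s) + t) * ((1 + r) * (1 + s) * (1 + s) + t))) := by
    field_simp; ring
  have key := kernel_numerator_eq r s t
  have q3 := kernel_coeff_three_nonneg hr hs h
  have q4 := kernel_coeff_four_nonneg hr hs h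
  have d1 : 0 < (r * r * s + t) * (r * s * s + t) := by positivity
  have d2 : 0 < (r * s * (1 + r) + t) * (r * s * (1 + s) + t) := by positivity
  have d3 : 0 < (r * (1 + r) * (1 + s) + t) * (s * (1 + r) * (1 + s) + t) := by positivity
  have d4 : 0 < ((1 + r) * (1 + r) * (1 + s) + t) * ((1 + r) * (1 + s) * (1 + s) + t) := by
    positivity
  rw [e1, e2, e3, e4, ← mul_add, ← mul_add, ← mul_add]
  refine mul_nonneg (sub_nonneg.2 hrs) ?_
  generalize (r * r * s + t) * (r * s * s + t) = D1 at *
  generalize (r * s * (1 + r) + t) * (r * s * (1 + s) + t) = D2 at *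
  generalize (r * (1 + r) * (1 + s) + t) * (s * (1 + r) * (1 + s) + t) = D3 at *
  generalize ((1 + r) * (1 + r) * (1 + s) + t) * ((1 + r) * (1 + s) * (1 + s) + t) = D4 at *
  rw [div_add_div _ _ d1.ne' d2.ne', div_add_div _ _ (mul_pos d1 d2).ne' d3.ne',
    div_add_div _ _ (mul_pos (mul_pos d1 d2) d3).ne' d4.ne']
  refine div_nonneg ?_ (by positivity)
  refine le_of_le_of_eq ?_ (key.symm.trans (by ring))
  positivity

/-- The sign of the derivative of the determinant along the curve of inscribed hexagons. -/
lemma exp_sum_nonneg {r s q : ℝ} (hr : 0 < r) (hrs : r ≤ s) (h : 1 ≤ r + s + 2 * (r * s))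
    (hq0 : 0 ≤ q) (hq1 : q ≤ 1) :
    0 ≤ ((1 + s) * (1 + s) ^ q - s * s ^ q)
        * (r ^ q * (1 + r) ^ q - r * (1 + r) ^ q * (1 + s) ^ q + (1 + r) * r ^ q * s ^ q)
      - ((1 + r) * (1 + r) ^ q - r * r ^ q)
        * (s ^ q * (1 + s) ^ q - s * (1 + r) ^ q * (1 + s) ^ q + (1 + s) * r ^ q * s ^ q) := by
  have hs : 0 < s := hr.trans_le hrs
  rcases hq0.eq_or_lt with rfl | hq0
  · simp
  rcases hq1.eq_or_lt with rfl | hq1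
  · simp only [rpow_one]
    exact le_of_eq (by ring)
  have H := sum_mul_rpow_nonneg Finset.univ
    ![r * (1 + s), -(s * (1 + r)), r + (1 + r) * (1 + s), -(s + (1 + r) * (1 + s)),
      1 + s - r * s, -(1 + r - r * s), s * (1 + r), -(r * (1 + s))]
    ![r * r * s, r * s * s, r * s * (1 + s), r * s * (1 + r), r * (1 + r) * (1 + s),
      s * (1 + r) * (1 + s), (1 + r) * (1 + r) * (1 + s), (1 + r) * (1 + s) * (1 + s)]
    (by intro i; fin_cases i <;> simp <;> positivity)
    (by
      intro t ht
      have := rational_kernel_nonneg hr hrs ht h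
      simp only [Fin.sum_univ_eight, Matrix.cons_val]
      linarith)
    ⟨hq0, hq1⟩
  simp only [Fin.sum_univ_eight, Matrix.cons_val] at H
  have hr1 : 0 < 1 + r := by positivity
  have hs1 : 0 < 1 + s := by positivity
  simp only [mul_rpow, hr.le, hs.le, hr1.le, hs1.le, mul_nonneg] at H
  refine H.trans_eq ?_
  ring

lemma mul_rpow_sub_one {x p : ℝ} (hx : 0 < x) : x * x ^ (p - 1) = x ^ p := by
  rw [rpow_sub_one hx.ne', mul_div_cancel₀ _ hx.ne']

lemma euclidean_curve_numerator_eq (r t : ℝ) :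
    -((1 + r) * (2 + r)) ^ 2
        * ((1 + r) * (1 + 2 * r) + t) * (2 + r + t) * (1 - r + t) * (r * (1 + 2 * r) + t)
        * (r * (1 - r) + t)
      + ((1 + r) * (1 + 2 * r)) ^ 2
        * ((1 + r) * (2 + r) + t) * (2 + r + t) * (1 - r + t) * (r * (1 + 2 * r) + t)
        * (r * (1 - r) + t)
      + (2 + r) ^ 2
        * ((1 + r) * (2 + r) + t) * ((1 + r) * (1 + 2 * r) + t) * (1 - r + t)
        * (r * (1 + 2 * r) + t) * (r * (1 - r) + t)
      - (1 - r) ^ 2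
        * ((1 + r) * (2 + r) + t) * ((1 + r) * (1 + 2 * r) + t) * (2 + r + t)
        * (r * (1 + 2 * r) + t) * (r * (1 - r) + t)
      - (r * (1 + 2 * r)) ^ 2
        * ((1 + r) * (2 + r) + t) * ((1 + r) * (1 + 2 * r) + t) * (2 + r + t) * (1 - r + t)
        * (r * (1 - r) + t)
      + (r * (1 - r)) ^ 2
        * ((1 + r) * (2 + r) + t) * ((1 + r) * (1 + 2 * r) + t) * (2 + r + t) * (1 - r + t)
        * (r * (1 + 2 * r) + t)
    = 2 * r * (1 - r) * (
      (r * (1 - r) * (1 + r) * (1 + 2 * r) * (2 + r)) ^ 2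
      + 2 * (r * (1 - r)) * ((1 + r) * (1 + 2 * r) * (2 + r)) ^ 2 * t
      + (4 + 46 * r + 137 * r ^ 2 + 172 * r ^ 3 + 73 * r ^ 4 - 34 * r ^ 5 - 50 * r ^ 6
        - 20 * r ^ 7 - 4 * r ^ 8) * t ^ 2
      + (12 + 66 * r + 120 * r ^ 2 + 100 * r ^ 3 + 30 * r ^ 4 - 4 * r ^ 6) * t ^ 3
      + (6 + 21 * r + 20 * r ^ 2 + 8 * r ^ 3 - r ^ 4) * t ^ 4) := by
  ring

lemma euclidean_curve_kernel_nonneg {r t : ℝ} (hr : 0 < r) (hr1 : r < 1) (ht : 0 < t) :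
    0 ≤ -((1 + r) * (2 + r)) * ((1 + r) * (2 + r) / ((1 + r) * (2 + r) + t))
      + (1 + r) * (1 + 2 * r) * ((1 + r) * (1 + 2 * r) / ((1 + r) * (1 + 2 * r) + t))
      + (2 + r) * ((2 + r) / (2 + r + t))
      + -(1 - r) * ((1 - r) / (1 - r + t))
      + -(r * (1 + 2 * r)) * (r * (1 + 2 * r) / (r * (1 + 2 * r) + t))
      + r * (1 - r) * (r * (1 - r) / (r * (1 - r) + t)) := by
  have h1 : 0 < 1 - r := sub_pos.2 hr1
  have key := euclidean_curve_numerator_eq r t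
  have c2 : 0 ≤ 4 + 46 * r + 137 * r ^ 2 + 172 * r ^ 3 + 73 * r ^ 4 - 34 * r ^ 5 - 50 * r ^ 6
      - 20 * r ^ 7 - 4 * r ^ 8 := by
    have h5 : r ^ 5 ≤ r ^ 3 := pow_le_pow_of_le_one hr.le hr1.le (by norm_num)
    have h6 : r ^ 6 ≤ r ^ 3 := pow_le_pow_of_le_one hr.le hr1.le (by norm_num)
    have h7 : r ^ 7 ≤ r ^ 3 := pow_le_pow_of_le_one hr.le hr1.le (by norm_num)
    have h8 : r ^ 8 ≤ r ^ 3 := pow_le_pow_of_le_one hr.le hr1.le (by norm_num)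
    have : 0 < r ^ 3 := by positivity
    have : 0 < r ^ 4 := by positivity
    have : 0 < r ^ 2 := by positivity
    linarith
  have c3 : 0 ≤ 12 + 66 * r + 120 * r ^ 2 + 100 * r ^ 3 + 30 * r ^ 4 - 4 * r ^ 6 := by
    have h6 : r ^ 6 ≤ r ^ 3 := pow_le_pow_of_le_one hr.le hr1.le (by norm_num)
    have : 0 < r ^ 3 := by positivity
    have : 0 < r ^ 4 := by positivity
    have : 0 < r ^ 2 := by positivity
    linarith
  have c4 : 0 ≤ 6 + 21 * r + 20 * r ^ 2 + 8 * r ^ 3 - r ^ 4 := by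
    have h6 : r ^ 4 ≤ r ^ 3 := pow_le_pow_of_le_one hr.le hr1.le (by norm_num)
    have : 0 < r ^ 3 := by positivity
    have : 0 < r ^ 2 := by positivity
    linarith
  have d1 : 0 < (1 + r) * (2 + r) + t := by positivity
  have d2 : 0 < (1 + r) * (1 + 2 * r) + t := by positivity
  have d3 : 0 < 2 + r + t := by positivity
  have d4 : 0 < 1 - r + t := by positivity
  have d5 : 0 < r * (1 + 2 * r) + t := by positivity
  have d6 : 0 < r * (1 - r) + t := by positivity
  simp only [← mul_div_assoc]
  rw [div_add_div _ _ d1.ne' d2.ne', div_add_div _ _ (mul_pos d1 d2).ne' d3.ne',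
    div_add_div _ _ (mul_pos (mul_pos d1 d2) d3).ne' d4.ne',
    div_add_div _ _ (mul_pos (mul_pos (mul_pos d1 d2) d3) d4).ne' d5.ne',
    div_add_div _ _ (mul_pos (mul_pos (mul_pos (mul_pos d1 d2) d3) d4) d5).ne' d6.ne']
  refine div_nonneg ?_ (by positivity)
  refine le_of_le_of_eq ?_ (key.symm.trans (by ring))
  positivity

lemma rpow_relation_le {r p : ℝ} (hr : 0 < r) (hr1 : r < 1) (hp1 : 1 ≤ p) (hp2 : p ≤ 2) :
    ((1 + r) ^ p - 1) * ((1 + (1 - r) / (1 + 2 * r)) ^ p - 1)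
      ≤ (1 - r ^ p) * (1 - ((1 - r) / (1 + 2 * r)) ^ p) := by
  have h1 : 0 < 1 - r := sub_pos.2 hr1
  have h2 : 0 < 1 + 2 * r := by positivity
  have h3 : 0 < 1 + r := by positivity
  have h4 : 0 < 2 + r := by positivity
  have key : 0 ≤ -((1 + r) * (2 + r)) ^ p + ((1 + r) * (1 + 2 * r)) ^ p + (2 + r) ^ p
      - (1 - r) ^ p - (r * (1 + 2 * r)) ^ p + (r * (1 - r)) ^ p := by
    rcases hp1.eq_or_lt with rfl | hp1
    · simp only [rpow_one]
      nlinarith [mul_pos hr h1]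
    rcases hp2.eq_or_lt with rfl | hp2
    · simp only [rpow_two]
      exact le_of_eq (by ring)
    have H := sum_mul_rpow_nonneg Finset.univ
      ![-((1 + r) * (2 + r)), (1 + r) * (1 + 2 * r), 2 + r, -(1 - r), -(r * (1 + 2 * r)),
        r * (1 - r)]
      ![(1 + r) * (2 + r), (1 + r) * (1 + 2 * r), 2 + r, 1 - r, r * (1 + 2 * r), r * (1 - r)]
      (by intro i; fin_cases i <;> simp <;> first | positivity | assumption)
      (by
        intro t ht
        have := euclidean_curve_kernel_nonneg hr hr1 ht
        simpa only [Fin.sum_univ_six, Matrix.cons_val] using this)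
      (q := p - 1) ⟨by linarith, by linarith⟩
    simp only [Fin.sum_univ_six, Matrix.cons_val] at H
    simp only [neg_mul] at H
    rw [mul_rpow_sub_one (by positivity), mul_rpow_sub_one (by positivity), mul_rpow_sub_one h4,
      mul_rpow_sub_one h1, mul_rpow_sub_one (by positivity),
      mul_rpow_sub_one (by positivity)] at H
    linarith
  have e1 : 1 + (1 - r) / (1 + 2 * r) = (2 + r) / (1 + 2 * r) := by field_simp; ring
  rw [e1, div_rpow h4.le h2.le, div_rpow h1.le h2.le]
  rw [mul_rpow h3.le h4.le, mul_rpow h3.le h2.le, mul_rpow hr.le h2.le, mul_rpow hr.le h1.le] at key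
  have hpos : 0 < (1 + 2 * r) ^ p := by positivity
  rw [← sub_nonneg]
  have : (1 - r ^ p) * (1 - (1 - r) ^ p / (1 + 2 * r) ^ p)
      - ((1 + r) ^ p - 1) * ((2 + r) ^ p / (1 + 2 * r) ^ p - 1)
      = (-((1 + r) ^ p * (2 + r) ^ p) + (1 + r) ^ p * (1 + 2 * r) ^ p + (2 + r) ^ p
        - (1 - r) ^ p - r ^ p * (1 + 2 * r) ^ p + r ^ p * (1 - r) ^ p) / (1 + 2 * r) ^ p := by
    field_simp; ring
  rw [this]
  exact div_nonneg key hpos.le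

/-- The curve of ratios of inscribed hexagons lies above the one for `p = 2`. -/
lemma one_le_of_rpow_relation {r s p : ℝ} (hr : 0 < r) (hr1 : r < 1) (hs : 0 < s)
    (hp1 : 1 ≤ p) (hp2 : p ≤ 2)
    (h : (1 - r ^ p) * (1 - s ^ p) = ((1 + r) ^ p - 1) * ((1 + s) ^ p - 1)) :
    1 ≤ r + s + 2 * (r * s) := by
  by_contra! hlt
  have hp : 0 < p := by linarith
  have hss : s < (1 - r) / (1 + 2 * r) := by
    rw [lt_div_iff₀ (by positivity)]
    linarith
  have a1 : r ^ p < 1 := rpow_lt_one hr.le hr1 hp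
  have a2 : 1 < (1 + r) ^ p := one_lt_rpow (by linarith) hp
  have a3 := rpow_lt_rpow hs.le hss hp
  have a4 := rpow_lt_rpow (by positivity : 0 ≤ 1 + s) (by linarith :
    1 + s < 1 + (1 - r) / (1 + 2 * r)) hp
  have := rpow_relation_le hr hr1 hp1 hp2
  nlinarith

lemma StrictAntiOn.exists_continuousOn_rightInverse {f : ℝ → ℝ} {a b : ℝ} (hab : a ≤ b)
    (hf : ContinuousOn f (Set.Icc a b)) (hanti : StrictAntiOn f (Set.Icc a b)) :
    ∃ g : ℝ → ℝ, ContinuousOn g (Set.Icc (f b) (f a)) ∧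
      ∀ v ∈ Set.Icc (f b) (f a), g v ∈ Set.Icc a b ∧ f (g v) = v := by
  have hex : ∀ v, ∃ x, v ∈ Set.Icc (f b) (f a) → x ∈ Set.Icc a b ∧ f x = v := by
    intro v
    by_cases hv : v ∈ Set.Icc (f b) (f a)
    · obtain ⟨x, hx, hxv⟩ := intermediate_value_Icc' hab hf hv
      exact ⟨x, fun _ => ⟨hx, hxv⟩⟩
    · exact ⟨0, fun h => absurd h hv⟩
  choose g hg using hex
  refine ⟨g, ?_, hg⟩
  have hemb : Topology.IsEmbedding ((Set.Icc a b).domRestrict f) :=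
    (Continuous.isClosedEmbedding hf.domRestrict
      (Set.injOn_iff_injective.1 hanti.injOn)).isEmbedding
  rw [continuousOn_iff_continuous_domRestrict]
  let g' : Set.Icc (f b) (f a) → Set.Icc a b := fun v => ⟨g v, (hg v v.2).1⟩
  have hg' : Continuous g' := by
    rw [hemb.continuous_iff]
    have : (Set.Icc a b).domRestrict f ∘ g' = Subtype.val := by
      funext v
      exact (hg v v.2).2
    rw [this]
    exact continuous_subtype_val
  exact continuous_subtype_val.comp hg'

/-- The increment `(1 + r) ^ p - r ^ p`. -/
def rpowGap (p r : ℝ) : ℝ := (1 + r) ^ p - r ^ p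

/-- The parameter `v` of the hexagon with ratios `r`, `s`, where
`(1 + v) (1 + r) ^ p + (1 - v) r ^ p = 2` and `(1 - v) (1 + s) ^ p + (1 + v) s ^ p = 2`. -/
def hexParam (p r : ℝ) : ℝ := (2 - (1 + r) ^ p - r ^ p) / rpowGap p r

lemma rpowGap_pos {p r : ℝ} (hp : 0 < p) (hr : 0 ≤ r) : 0 < rpowGap p r :=
  sub_pos.2 (rpow_lt_rpow hr (by linarith) hp)

lemma hasDerivAt_rpowGap {p r : ℝ} (hr : 0 < r) :
    HasDerivAt (rpowGap p) (p * ((1 + r) ^ (p - 1) - r ^ (p - 1))) r := by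
  have h1 := ((hasDerivAt_id r).const_add 1).rpow_const (p := p) (Or.inl (by simp; positivity))
  have h2 := (hasDerivAt_id r).rpow_const (p := p) (Or.inl hr.ne')
  refine (h1.sub h2).congr_deriv ?_
  simp only [id]
  ring

lemma continuous_rpowGap {p : ℝ} (hp : 0 < p) : Continuous (rpowGap p) := by
  unfold rpowGap
  exact ((continuous_const.add continuous_id).rpow_const fun _ => Or.inr hp.le).sub
    (continuous_id.rpow_const fun _ => Or.inr hp.le)

lemma rpowGap_eq {p r : ℝ} (hr : 0 < r) :
    rpowGap p r = (1 + r) * (1 + r) ^ (p - 1) - r * r ^ (p - 1) := by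
  rw [rpowGap, mul_rpow_sub_one hr, mul_rpow_sub_one (by linarith)]

lemma hasDerivAt_hexParam {p r : ℝ} (hp : 0 < p) (hr : 0 < r) :
    HasDerivAt (hexParam p) (-(2 * p * ((1 + r) ^ (p - 1) - r ^ (p - 1)
      + r ^ (p - 1) * (1 + r) ^ (p - 1)) / rpowGap p r ^ 2)) r := by
  have h1 := ((hasDerivAt_id r).const_add 1).rpow_const (p := p) (Or.inl (by simp; positivity))
  have h2 := (hasDerivAt_id r).rpow_const (p := p) (Or.inl hr.ne')
  refine (((h1.const_sub 2).sub h2).div (hasDerivAt_rpowGap hr)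
    (rpowGap_pos hp hr.le).ne').congr_deriv ?_
  simp only [id, Pi.sub_apply]
  rw [rpowGap_eq hr, ← mul_rpow_sub_one (p := p) hr,
    ← mul_rpow_sub_one (p := p) (by linarith : 0 < 1 + r)]
  ring

lemma hexParam_deriv_pos {p r : ℝ} (hp : 1 ≤ p) (hr : 0 < r) :
    0 < (1 + r) ^ (p - 1) - r ^ (p - 1) + r ^ (p - 1) * (1 + r) ^ (p - 1) := by
  have := rpow_le_rpow hr.le (by linarith : r ≤ 1 + r) (by linarith : 0 ≤ p - 1)
  have : 0 < r ^ (p - 1) * (1 + r) ^ (p - 1) := by positivity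
  linarith

lemma continuousOn_hexParam {p : ℝ} (hp : 0 < p) : ContinuousOn (hexParam p) (Set.Icc 0 1) := by
  unfold hexParam
  refine ContinuousOn.div ?_ (continuous_rpowGap hp).continuousOn
    fun r hr => (rpowGap_pos hp hr.1).ne'
  exact (((continuous_const.sub ((continuous_const.add continuous_id).rpow_const
    fun _ => Or.inr hp.le)).sub (continuous_id.rpow_const fun _ => Or.inr hp.le))).continuousOn

lemma strictAntiOn_hexParam {p : ℝ} (hp : 1 ≤ p) : StrictAntiOn (hexParam p) (Set.Icc 0 1) := by
  have hp0 : 0 < p := by linarith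
  refine strictAntiOn_of_deriv_neg (convex_Icc 0 1) (continuousOn_hexParam hp0) fun r hr => ?_
  rw [interior_Icc] at hr
  rw [(hasDerivAt_hexParam hp0 hr.1).deriv, neg_lt_zero]
  have := rpowGap_pos hp0 hr.1.le
  have := hexParam_deriv_pos hp hr.1
  positivity

lemma hexParam_zero {p : ℝ} (hp : 0 < p) : hexParam p 0 = 1 := by
  simp [hexParam, rpowGap, zero_rpow hp.ne']
  norm_num

lemma hexParam_one {p : ℝ} (hp : 0 < p) : hexParam p 1 = -1 := by
  have := rpowGap_pos hp zero_le_one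
  rw [hexParam, div_eq_iff this.ne', rpowGap]
  simp
  ring

/-- Logarithm of four times the `p`-th power of the determinant of the hexagon with ratios
`r` and `s`. -/
def logDet (p r s : ℝ) : ℝ :=
  p * log (1 + r + s) + log (rpowGap p r) + log (rpowGap p s)
    - 2 * log (rpowGap p r + rpowGap p s)

lemma logDet_deriv_nonneg {p r s : ℝ} (hp1 : 1 ≤ p) (hp2 : p ≤ 2) (hr : 0 < r) (hr1 : r < 1)
    (hrs : r ≤ s) (h : hexParam p s = -hexParam p r) :
    0 ≤ (rpowGap p s ^ 2 / ((1 + s) ^ (p - 1) - s ^ (p - 1) + s ^ (p - 1) * (1 + s) ^ (p - 1))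
        - rpowGap p r ^ 2 / ((1 + r) ^ (p - 1) - r ^ (p - 1) + r ^ (p - 1) * (1 + r) ^ (p - 1)))
          / (1 + r + s)
      - (rpowGap p s - rpowGap p r) / (rpowGap p r + rpowGap p s)
        * (((1 + r) ^ (p - 1) - r ^ (p - 1)) * rpowGap p r
            / ((1 + r) ^ (p - 1) - r ^ (p - 1) + r ^ (p - 1) * (1 + r) ^ (p - 1))
          + ((1 + s) ^ (p - 1) - s ^ (p - 1)) * rpowGap p s
            / ((1 + s) ^ (p - 1) - s ^ (p - 1) + s ^ (p - 1) * (1 + s) ^ (p - 1))) := by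
  have hs : 0 < s := hr.trans_le hrs
  have hp0 : 0 < p := by linarith
  have hE := rpowGap_pos hp0 hr.le
  have hF := rpowGap_pos hp0 hs.le
  have K : (2 - (1 + r) ^ p - r ^ p) * rpowGap p s + (2 - (1 + s) ^ p - s ^ p) * rpowGap p r
      = 0 := by
    rw [hexParam, hexParam] at h
    field_simp at h
    linarith
  have hc : 1 ≤ r + s + 2 * (r * s) := by
    refine one_le_of_rpow_relation hr hr1 hs hp1 hp2 ?_
    rw [rpowGap, rpowGap] at K
    linarith
  have hT := exp_sum_nonneg hr hrs hc (q := p - 1) (by linarith) (by linarith)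
  have hm := hexParam_deriv_pos hp1 hr
  have hn := hexParam_deriv_pos hp1 hs
  have eE := rpowGap_eq (p := p) hr
  have eF := rpowGap_eq (p := p) hs
  rw [← eE, ← eF] at hT
  rw [← mul_rpow_sub_one hr, ← mul_rpow_sub_one hs, ← mul_rpow_sub_one (by linarith : 0 < 1 + r),
    ← mul_rpow_sub_one (by linarith : 0 < 1 + s)] at K
  generalize rpowGap p r = E at *
  generalize rpowGap p s = F at *
  generalize r ^ (p - 1) = x at *
  generalize (1 + r) ^ (p - 1) = x1 at *
  generalize s ^ (p - 1) = y at *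
  generalize (1 + s) ^ (p - 1) = y1 at *
  obtain ⟨m, hm'⟩ : ∃ m, x1 - x + x * x1 = E * m := ⟨(x1 - x + x * x1) / E, by field_simp⟩
  obtain ⟨n, hn'⟩ : ∃ n, y1 - y + y * y1 = F * n := ⟨(y1 - y + y * y1) / F, by field_simp⟩
  have m0 : 0 < m := pos_of_mul_pos_right (hm' ▸ hm) hE.le
  have n0 : 0 < n := pos_of_mul_pos_right (hn' ▸ hn) hF.le
  have hFm : F * m = (1 + s) * x1 * y1 - x1 + x - s * x * y := by
    apply mul_left_cancel₀ hE.ne'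
    have : E * (F * m) = F * (E * m) := by ring
    rw [this, ← hm']
    subst eE eF
    linear_combination (x1 - x) / 2 * K
  have hEn : E * n = (1 + r) * x1 * y1 - y1 + y - r * x * y := by
    apply mul_left_cancel₀ hF.ne'
    have : F * (E * n) = E * (F * n) := by ring
    rw [this, ← hn']
    subst eE eF
    linear_combination (y1 - y) / 2 * K
  have hmn : (x1 - x) * n + (y1 - y) * m = x1 * y1 - x * y := by
    apply mul_left_cancel₀ hE.ne'
    apply mul_left_cancel₀ hF.ne'
    have : F * (E * ((x1 - x) * n + (y1 - y) * m))
      = (x1 - x) * E * (F * n) + (y1 - y) * F * (E * m) := by ring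
    rw [this, ← hm', ← hn']
    subst eE eF
    linear_combination (x1 - x) * (y1 - y) / 2 * K
  rw [hm', hn']
  have hw : 0 < 1 + r + s := by positivity
  have : (F ^ 2 / (F * n) - E ^ 2 / (E * m)) / (1 + r + s)
      - (F - E) / (E + F) * ((x1 - x) * E / (E * m) + (y1 - y) * F / (F * n))
      = ((E + F) * (F * m - E * n) - (1 + r + s) * (F - E) * ((x1 - x) * n + (y1 - y) * m))
        / (m * n * (E + F) * (1 + r + s)) := by
    field_simp
  rw [this]
  refine div_nonneg ?_ (by positivity)
  refine hT.trans_eq ?_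
  rw [hmn]
  have h1 : (E + F) * (F * m - E * n)
      = F * (E * m + F * m) - E * (E * n + F * n) := by ring
  rw [h1, hFm, hEn, ← hm', ← hn']
  ring

lemma hasDerivAt_logDet {p a b a' b' x : ℝ} {f g : ℝ → ℝ} (hp : 0 < p) (ha : 0 < a) (hb : 0 < b)
    (hfx : f x = a) (hgx : g x = b) (hf : HasDerivAt f a' x) (hg : HasDerivAt g b' x) :
    HasDerivAt (fun v => logDet p (f v) (g v))
      (p * ((a' + b') / (1 + a + b))
        + p * ((1 + a) ^ (p - 1) - a ^ (p - 1)) * a' / rpowGap p a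
        + p * ((1 + b) ^ (p - 1) - b ^ (p - 1)) * b' / rpowGap p b
        - 2 * ((p * ((1 + a) ^ (p - 1) - a ^ (p - 1)) * a'
          + p * ((1 + b) ^ (p - 1) - b ^ (p - 1)) * b') / (rpowGap p a + rpowGap p b))) x := by
  subst hfx hgx
  have hE := rpowGap_pos hp ha.le
  have hF := rpowGap_pos hp hb.le
  have h1 := (hasDerivAt_rpowGap (p := p) ha).comp x hf
  have h2 := (hasDerivAt_rpowGap (p := p) hb).comp x hg
  exact ((((((hf.const_add 1).add hg).log (by simp; positivity)).const_mul p).add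
    (h1.log hE.ne')).add (h2.log hF.ne')).sub (((h1.add h2).log (add_pos hE hF).ne').const_mul 2)

/-- The logarithm of the determinant increases along the curve of inscribed hexagons, away
from the symmetric one. -/
lemma logDet_le_logDet {p r s r₀ : ℝ} (hp1 : 1 ≤ p) (hp2 : p ≤ 2) (hr : r ∈ Set.Icc 0 1)
    (hs : s ∈ Set.Icc 0 1) (hrs : r ≤ s) (h : hexParam p s = -hexParam p r)
    (hr₀ : r₀ ∈ Set.Icc 0 1) (h₀ : hexParam p r₀ = 0) :
    logDet p r₀ r₀ ≤ logDet p r s := by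
  have hp0 : 0 < p := by linarith
  have hanti := strictAntiOn_hexParam hp1
  obtain ⟨R, hRc, hR⟩ := hanti.exists_continuousOn_rightInverse zero_le_one
    (continuousOn_hexParam hp0)
  rw [hexParam_zero hp0, hexParam_one hp0] at hRc hR
  have hRuniq : ∀ x ∈ Set.Icc (0 : ℝ) 1, R (hexParam p x) = x := by
    intro x hx
    have hmem : hexParam p x ∈ Set.Icc (-1 : ℝ) 1 := by
      have h1 := hanti.antitoneOn hx (Set.right_mem_Icc.2 zero_le_one) hx.2
      have h2 := hanti.antitoneOn (Set.left_mem_Icc.2 zero_le_one) hx hx.1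
      rw [hexParam_one hp0] at h1
      rw [hexParam_zero hp0] at h2
      exact ⟨h1, h2⟩
    exact hanti.injOn (hR _ hmem).1 hx (hR _ hmem).2
  have hRanti : ∀ u ∈ Set.Icc (-1 : ℝ) 1, ∀ v ∈ Set.Icc (-1 : ℝ) 1, u < v → R v < R u := by
    intro u hu v hv huv
    rw [← hanti.lt_iff_gt (hR u hu).1 (hR v hv).1, (hR u hu).2, (hR v hv).2]
    exact huv
  have hRpos : ∀ v ∈ Set.Ioo (-1 : ℝ) 1, R v ∈ Set.Ioo (0 : ℝ) 1 := by
    intro v hv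
    have h1 := hRanti v ⟨hv.1.le, hv.2.le⟩ 1 ⟨by norm_num, le_rfl⟩ hv.2
    have h2 := hRanti (-1) ⟨le_rfl, by norm_num⟩ v ⟨hv.1.le, hv.2.le⟩ hv.1
    exact ⟨(hR 1 ⟨by norm_num, le_rfl⟩).1.1.trans_lt h1,
      h2.trans_le (hR (-1) ⟨le_rfl, by norm_num⟩).1.2⟩
  have hRd : ∀ v ∈ Set.Ioo (-1 : ℝ) 1, HasDerivAt R (-(2 * p * ((1 + R v) ^ (p - 1)
      - R v ^ (p - 1) + R v ^ (p - 1) * (1 + R v) ^ (p - 1)) / rpowGap p (R v) ^ 2))⁻¹ v := by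
    intro v hv
    have hn := Icc_mem_nhds hv.1 hv.2
    have := rpowGap_pos hp0 (hRpos v hv).1.le
    have := hexParam_deriv_pos hp1 (hRpos v hv).1
    refine (hasDerivAt_hexParam hp0 (hRpos v hv).1).of_local_left_inverse
      (hRc.continuousAt hn) (neg_ne_zero.2 (by positivity)) ?_
    filter_upwards [hn] with y hy using (hR y hy).2
  have hneg : Set.MapsTo (fun v : ℝ => -v) (Set.Icc 0 1) (Set.Icc (-1) 1) :=
    fun v hv => ⟨neg_le_neg hv.2, by linarith [hv.1]⟩
  have hsub : Set.Icc (0 : ℝ) 1 ⊆ Set.Icc (-1) 1 := Set.Icc_subset_Icc_left (by norm_num)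
  have hmono : MonotoneOn (fun v => logDet p (R v) (R (-v))) (Set.Icc 0 1) := by
    have hRl := hRc.mono hsub
    have hRr : ContinuousOn (fun v => R (-v)) (Set.Icc 0 1) :=
      hRc.comp continuous_neg.continuousOn hneg
    have hE := (continuous_rpowGap hp0).comp_continuousOn hRl
    have hF := (continuous_rpowGap hp0).comp_continuousOn hRr
    have hE0 : ∀ v ∈ Set.Icc (0 : ℝ) 1, 0 < rpowGap p (R v) :=
      fun v hv => rpowGap_pos hp0 (hR v (hsub hv)).1.1
    have hF0 : ∀ v ∈ Set.Icc (0 : ℝ) 1, 0 < rpowGap p (R (-v)) :=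
      fun v hv => rpowGap_pos hp0 (hR _ (hneg hv)).1.1
    refine monotoneOn_of_deriv_nonneg (convex_Icc 0 1) ?_ ?_ ?_
    · refine ContinuousOn.sub (ContinuousOn.add (ContinuousOn.add (ContinuousOn.mul
        continuousOn_const (ContinuousOn.log ((continuousOn_const.add hRl).add hRr) ?_))
        (hE.log fun v hv => (hE0 v hv).ne')) (hF.log fun v hv => (hF0 v hv).ne'))
        (continuousOn_const.mul ((hE.add hF).log fun v hv => (add_pos (hE0 v hv) (hF0 v hv)).ne'))
      intro v hv
      have := (hR v (hsub hv)).1.1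
      have := (hR _ (hneg hv)).1.1
      positivity
    all_goals rw [interior_Icc]
    all_goals
      intro v hv
      have hv1 : v ∈ Set.Ioo (-1 : ℝ) 1 := ⟨by linarith [hv.1], hv.2⟩
      have hv2 : -v ∈ Set.Ioo (-1 : ℝ) 1 := ⟨neg_lt_neg hv.2, by linarith [hv.1]⟩
      have hd := hasDerivAt_logDet hp0 (hRpos v hv1).1 (hRpos _ hv2).1 rfl rfl (hRd v hv1)
        ((hRd (-v) hv2).comp v (hasDerivAt_neg v))
    · exact hd.differentiableAt.differentiableWithinAt
    · refine le_of_le_of_eq ?_ hd.deriv.symm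
      have hlt := hRanti (-v) ⟨hv2.1.le, hv2.2.le⟩ v ⟨hv1.1.le, hv1.2.le⟩ (by linarith [hv.1])
      have key := logDet_deriv_nonneg hp1 hp2 (hRpos v hv1).1 (hRpos v hv1).2 hlt.le (by
        rw [(hR _ ⟨hv2.1.le, hv2.2.le⟩).2, (hR _ ⟨hv1.1.le, hv1.2.le⟩).2])
      have hE := rpowGap_pos hp0 (hRpos v hv1).1.le
      have hF := rpowGap_pos hp0 (hRpos _ hv2).1.le
      have hm := hexParam_deriv_pos hp1 (hRpos v hv1).1
      have hn := hexParam_deriv_pos hp1 (hRpos _ hv2).1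
      have hw : 0 < 1 + R v + R (-v) := by linarith [(hRpos v hv1).1, (hRpos _ hv2).1]
      refine (mul_nonneg one_half_pos.le key).trans_eq ?_
      generalize R v = r at *
      generalize R (-v) = s at *
      generalize rpowGap p r = E at *
      generalize rpowGap p s = F at *
      generalize (1 + r) ^ (p - 1) - r ^ (p - 1) = c at *
      generalize (1 + s) ^ (p - 1) - s ^ (p - 1) = d at *
      generalize c + r ^ (p - 1) * (1 + r) ^ (p - 1) = m at *
      generalize d + s ^ (p - 1) * (1 + s) ^ (p - 1) = n at *
      generalize 1 + r + s = w at *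
      field_simp
      ring
  have hv0 : 0 ≤ hexParam p r := by
    have := hanti.antitoneOn hr hs hrs
    linarith
  have hv1 : hexParam p r ≤ 1 := by
    have := hanti.antitoneOn (Set.left_mem_Icc.2 zero_le_one) hr hr.1
    rwa [hexParam_zero hp0] at this
  have := hmono ⟨le_rfl, zero_le_one⟩ ⟨hv0, hv1⟩ hv0
  simp only [neg_zero] at this
  rwa [← h, hRuniq r hr, hRuniq s hs, ← h₀, hRuniq r₀ hr₀] at this

lemma rpow_log_le_of_logDet_le {p r s r₀ : ℝ} (hp1 : 1 ≤ p) (hr : 0 ≤ r) (hs : 0 ≤ s)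
    (hr₀ : 0 ≤ r₀) (h : logDet p r₀ r₀ ≤ logDet p r s) :
    (1 + 2 * r₀) ^ p / 4 ≤
      (1 + r + s) ^ p * (rpowGap p r * rpowGap p s / (rpowGap p r + rpowGap p s) ^ 2) := by
  have hp0 : 0 < p := by linarith
  have hE := rpowGap_pos hp0 hr
  have hF := rpowGap_pos hp0 hs
  have hG := rpowGap_pos hp0 hr₀
  have hexp : ∀ x y, 0 ≤ x → 0 ≤ y → exp (logDet p x y)
      = (1 + x + y) ^ p * (rpowGap p x * rpowGap p y / (rpowGap p x + rpowGap p y) ^ 2) := by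
    intro x y hx hy
    have hX := rpowGap_pos hp0 hx
    have hY := rpowGap_pos hp0 hy
    rw [logDet, exp_sub, exp_add, exp_add, exp_log hX, exp_log hY, mul_comm p,
      ← rpow_def_of_pos (by positivity), mul_comm 2, exp_mul, exp_log (by positivity), rpow_two]
    ring
  have := exp_le_exp.2 h
  rw [hexp _ _ hr₀ hr₀, hexp _ _ hr hs] at this
  refine le_of_eq_of_le ?_ this
  rw [show 1 + r₀ + r₀ = 1 + 2 * r₀ by ring]
  field_simp
  ring

lemma hexagon_det_ge_of_le {p a b c d r₀ : ℝ} (hp1 : 1 ≤ p) (hp2 : p ≤ 2) (ha : 0 ≤ a)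
    (hb : 0 < b) (hc : 0 < c) (hd : 0 ≤ d) (hr₀ : r₀ ∈ Set.Icc 0 1)
    (h₀ : r₀ ^ p + (1 + r₀) ^ p = 2) (h1 : a ^ p + (c + d) ^ p = 1) (h2 : b ^ p + c ^ p = 1)
    (h3 : (a + b) ^ p + d ^ p = 1)
    (h : a * c ≤ d * b) :
    4 ^ (-(1 / p)) * (1 + 2 * r₀) ≤ a * c + b * c + b * d := by
  have hp0 : 0 < p := by linarith
  obtain ⟨r, hr0, rfl⟩ : ∃ r, 0 ≤ r ∧ a = r * b := ⟨a / b, by positivity, by field_simp⟩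
  obtain ⟨s, hs0, rfl⟩ : ∃ s, 0 ≤ s ∧ d = s * c := ⟨d / c, by positivity, by field_simp⟩
  have hrs : r ≤ s := by
    refine le_of_mul_le_mul_right (?_ : r * (b * c) ≤ s * (b * c)) (mul_pos hb hc)
    linarith
  have hE := rpowGap_pos hp0 hr0
  have hF := rpowGap_pos hp0 hs0
  have hX : 0 < b ^ p := by positivity
  have hY : 0 < c ^ p := by positivity
  rw [show c + s * c = (1 + s) * c by ring, mul_rpow hr0 hb.le,
    mul_rpow (by positivity) hc.le] at h1
  rw [show r * b + b = (1 + r) * b by ring, mul_rpow hs0 hc.le,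
    mul_rpow (by positivity) hb.le] at h3
  have hr1 : r ≤ 1 := by
    by_contra! hlt
    have := one_lt_rpow hlt hp0
    have := one_le_rpow (by linarith : 1 ≤ 1 + s) hp0.le
    nlinarith
  have hs1 : s ≤ 1 := by
    by_contra! hlt
    have := one_lt_rpow hlt hp0
    have := one_le_rpow (by linarith : 1 ≤ 1 + r) hp0.le
    nlinarith
  have hXY : b ^ p * rpowGap p r = c ^ p * rpowGap p s := by
    rw [rpowGap, rpowGap]
    linarith
  have hpar : hexParam p s = -hexParam p r := by
    rw [hexParam, hexParam, ← neg_div, div_eq_div_iff hF.ne' hE.ne']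
    apply mul_left_cancel₀ hX.ne'
    linear_combination (2 - (1 + s) ^ p - s ^ p) * hXY - rpowGap p s * h1 - rpowGap p s * h3
      + 2 * rpowGap p s * h2
  have hpar₀ : hexParam p r₀ = 0 := by
    rw [hexParam, div_eq_zero_iff]
    left
    linarith
  have key := rpow_log_le_of_logDet_le hp1 hr0 hs0 hr₀.1
    (logDet_le_logDet hp1 hp2 ⟨hr0, hr1⟩ ⟨hs0, hs1⟩ hrs hpar hr₀ hpar₀)
  have hprod : rpowGap p r * rpowGap p s / (rpowGap p r + rpowGap p s) ^ 2 = b ^ p * c ^ p := by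
    have e1 : rpowGap p s = b ^ p * (rpowGap p r + rpowGap p s) := by
      linear_combination -rpowGap p s * h2 - hXY
    have e2 : rpowGap p r = c ^ p * (rpowGap p r + rpowGap p s) := by
      linear_combination -rpowGap p r * h2 + hXY
    have hS := add_pos hE hF
    generalize rpowGap p r + rpowGap p s = S at *
    rw [e1, e2]
    field_simp
  rw [hprod] at key
  have hr₀' := hr₀.1
  rw [← rpow_le_rpow_iff (by positivity) (by positivity) hp0]
  refine le_of_eq_of_le ?_ (key.trans_eq ?_)
  · rw [mul_rpow (by positivity) (by positivity), ← rpow_mul (by norm_num)]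
    have : -(1 / p) * p = -1 := by field_simp
    rw [this, rpow_neg_one]
    ring
  · rw [← mul_rpow hb.le hc.le, ← mul_rpow (by positivity) (by positivity)]
    congr 1
    ring

/-- Lower bound for the determinant of a hexagon inscribed in the unit circle, in terms of the
absolute values of the coordinates of its vertices. -/
lemma hexagon_det_ge {p a b c d r₀ : ℝ} (hp1 : 1 ≤ p) (hp2 : p ≤ 2) (ha : 0 ≤ a)
    (hb : 0 ≤ b) (hc : 0 ≤ c) (hd : 0 ≤ d) (hr₀ : r₀ ∈ Set.Icc 0 1)
    (h₀ : r₀ ^ p + (1 + r₀) ^ p = 2) (h1 : a ^ p + (c + d) ^ p = 1) (h2 : b ^ p + c ^ p = 1)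
    (h3 : (a + b) ^ p + d ^ p = 1) :
    4 ^ (-(1 / p)) * (1 + 2 * r₀) ≤ a * c + b * c + b * d := by
  have hp0 : 0 < p := by linarith
  have hpos : ∀ {a b c d : ℝ}, 0 ≤ a → 0 ≤ b → 0 ≤ c → 0 ≤ d → a ^ p + (c + d) ^ p = 1 →
      b ^ p + c ^ p = 1 → (a + b) ^ p + d ^ p = 1 → 0 < b := by
    intro a b c d ha hb hc hd h1 h2 h3
    refine hb.lt_of_ne' fun hb => ?_
    subst hb
    rw [zero_rpow hp0.ne', zero_add] at h2
    have hc1 : c = 1 := by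
      rw [← one_rpow p] at h2
      exact (rpow_left_inj hc zero_le_one hp0.ne').1 h2
    subst hc1
    rw [add_zero] at h3
    have hd0 : d = 0 := by
      by_contra hd0
      have := one_lt_rpow (by linarith [hd.lt_of_ne' hd0] : 1 < 1 + d) hp0
      have : 0 ≤ a ^ p := by positivity
      linarith
    subst hd0
    rw [zero_rpow hp0.ne', add_zero] at h3
    rw [add_zero, h2] at h1
    linarith
  have hb' := hpos ha hb hc hd h1 h2 h3
  have hc' := hpos hd hc hb ha (by rw [add_comm, add_comm b]; exact h3) (by rwa [add_comm])
    (by rw [add_comm, add_comm d]; exact h1)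
  rcases le_total (a * c) (d * b) with h | h
  · exact hexagon_det_ge_of_le hp1 hp2 ha hb' hc' hd hr₀ h₀ h1 h2 h3 h
  · have := hexagon_det_ge_of_le hp1 hp2 hd hc' hb' ha hr₀ h₀
      (by rw [add_comm, add_comm b]; exact h3)
      (by rwa [add_comm]) (by rw [add_comm, add_comm d]; exact h1) h
    linarith

lemma triangle_det_ge_of_mul_nonneg {p r₀ x₁ x₂ x₃ y₁ y₂ y₃ : ℝ} (hp1 : 1 ≤ p) (hp2 : p ≤ 2)
    (hr₀ : r₀ ∈ Set.Icc 0 1) (h₀ : r₀ ^ p + (1 + r₀) ^ p = 2)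
    (hx : x₁ + x₂ + x₃ = 0) (hy : y₁ + y₂ + y₃ = 0)
    (h1 : |x₁| ^ p + |y₁| ^ p = 1) (h2 : |x₂| ^ p + |y₂| ^ p = 1) (h3 : |x₃| ^ p + |y₃| ^ p = 1)
    (hxx : 0 ≤ x₁ * x₂) (hyy : 0 ≤ y₂ * y₃) :
    4 ^ (-(1 / p)) * (1 + 2 * r₀) ≤ |x₁ * y₂ - y₁ * x₂| := by
  have hx3 : |x₃| = |x₁| + |x₂| := by
    rw [← abs_add_eq_add_abs_iff _ _ |>.2 (mul_nonneg_iff.1 hxx), ← abs_neg x₃]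
    congr 1
    linarith
  have hy1 : |y₁| = |y₂| + |y₃| := by
    rw [← abs_add_eq_add_abs_iff _ _ |>.2 (mul_nonneg_iff.1 hyy), ← abs_neg y₁]
    congr 1
    linarith
  rw [hx3] at h3
  rw [hy1] at h1
  refine (hexagon_det_ge hp1 hp2 (abs_nonneg _) (abs_nonneg _) (abs_nonneg _) (abs_nonneg _) hr₀ h₀
    h1 h2 h3).trans (le_of_eq ?_)
  have e : x₁ * y₂ - y₁ * x₂ = x₁ * y₂ + x₂ * y₂ + x₂ * y₃ := by linear_combination -x₂ * hy
  rw [e]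
  rcases mul_nonneg_iff.1 hxx with ⟨ha, hb⟩ | ⟨ha, hb⟩ <;>
    rcases mul_nonneg_iff.1 hyy with ⟨hc, hd⟩ | ⟨hc, hd⟩ <;>
    simp only [← abs_mul]
  · rw [abs_of_nonneg (mul_nonneg ha hc), abs_of_nonneg (mul_nonneg hb hc),
      abs_of_nonneg (mul_nonneg hb hd), abs_of_nonneg (by positivity)]
  · have k1 := mul_nonpos_of_nonneg_of_nonpos ha hc
    have k2 := mul_nonpos_of_nonneg_of_nonpos hb hc
    have k3 := mul_nonpos_of_nonneg_of_nonpos hb hd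
    rw [abs_of_nonpos k1, abs_of_nonpos k2, abs_of_nonpos k3, abs_of_nonpos (by linarith)]
    ring
  · have k1 := mul_nonpos_of_nonpos_of_nonneg ha hc
    have k2 := mul_nonpos_of_nonpos_of_nonneg hb hc
    have k3 := mul_nonpos_of_nonpos_of_nonneg hb hd
    rw [abs_of_nonpos k1, abs_of_nonpos k2, abs_of_nonpos k3, abs_of_nonpos (by linarith)]
    ring
  · have k1 := mul_nonneg_of_nonpos_of_nonpos ha hc
    have k2 := mul_nonneg_of_nonpos_of_nonpos hb hc
    have k3 := mul_nonneg_of_nonpos_of_nonpos hb hd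
    rw [abs_of_nonneg k1, abs_of_nonneg k2, abs_of_nonneg k3, abs_of_nonneg (by linarith)]

lemma exists_mul_nonneg_of_three (x y z : ℝ) : 0 ≤ x * y ∨ 0 ≤ y * z ∨ 0 ≤ z * x := by
  by_contra! h
  have := mul_neg_of_pos_of_neg (mul_pos_of_neg_of_neg h.1 h.2.1) h.2.2
  nlinarith [sq_nonneg (x * y * z)]

lemma abs_rpow_add_le {x y p : ℝ} (hp : 1 ≤ p) (h : 0 ≤ x * y) :
    |x| ^ p + |y| ^ p ≤ |x + y| ^ p := by
  rw [abs_add_eq_add_abs_iff _ _ |>.2 (mul_nonneg_iff.1 h)]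
  exact add_rpow_le_rpow_add (abs_nonneg x) (abs_nonneg y) hp

/-- Three unit vectors summing to zero span a lattice of determinant at least that of the
symmetric inscribed hexagon. -/
lemma triangle_det_ge {p r₀ x₁ x₂ x₃ y₁ y₂ y₃ : ℝ} (hp1 : 1 ≤ p) (hp2 : p ≤ 2)
    (hr₀ : r₀ ∈ Set.Icc 0 1) (h₀ : r₀ ^ p + (1 + r₀) ^ p = 2)
    (hx : x₁ + x₂ + x₃ = 0) (hy : y₁ + y₂ + y₃ = 0)
    (h1 : |x₁| ^ p + |y₁| ^ p = 1) (h2 : |x₂| ^ p + |y₂| ^ p = 1)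
    (h3 : |x₃| ^ p + |y₃| ^ p = 1) :
    4 ^ (-(1 / p)) * (1 + 2 * r₀) ≤ |x₁ * y₂ - y₁ * x₂| := by
  have hsame : ∀ {x y x' y' x'' y'' : ℝ}, |x| ^ p + |y| ^ p = 1 → |x'| ^ p + |y'| ^ p = 1 →
      |x''| ^ p + |y''| ^ p = 1 → x + x' + x'' = 0 → y + y' + y'' = 0 → 0 ≤ x * x' →
      ¬ 0 ≤ y * y' := by
    intro x y x' y' x'' y'' h h' h'' hx hy hxx hyy
    have k1 := abs_rpow_add_le hp1 hxx
    have k2 := abs_rpow_add_le hp1 hyy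
    rw [show x + x' = -x'' by linarith, abs_neg] at k1
    rw [show y + y' = -y'' by linarith, abs_neg] at k2
    linarith
  have e : ∀ {u v : ℝ}, u = v ∨ u = -v → |u| = |v| := abs_eq_abs.2
  have main := @triangle_det_ge_of_mul_nonneg p r₀
  rcases exists_mul_nonneg_of_three x₁ x₂ x₃ with hxx | hxx | hxx <;>
    rcases exists_mul_nonneg_of_three y₁ y₂ y₃ with hyy | hyy | hyy
  · exact absurd hyy (hsame h1 h2 h3 hx hy hxx)
  · exact main hp1 hp2 hr₀ h₀ hx hy h1 h2 h3 hxx hyy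
  · rw [e (Or.inr (by ring) : x₁ * y₂ - y₁ * x₂ = x₂ * y₁ - y₂ * x₁ ∨ _)]
    exact main hp1 hp2 hr₀ h₀ (by linarith) (by linarith) h2 h1 h3 (by linarith) (by linarith)
  · rw [e (Or.inr (by linear_combination y₂ * hx - x₂ * hy) :
      x₁ * y₂ - y₁ * x₂ = x₃ * y₂ - y₃ * x₂ ∨ _)]
    exact main hp1 hp2 hr₀ h₀ (by linarith) (by linarith) h3 h2 h1 (by linarith) (by linarith)
  · exact absurd hyy (hsame h2 h3 h1 (by linarith) (by linarith) hxx)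
  · rw [e (Or.inl (by linear_combination y₂ * hx - x₂ * hy) :
      x₁ * y₂ - y₁ * x₂ = x₂ * y₃ - y₂ * x₃ ∨ _)]
    exact main hp1 hp2 hr₀ h₀ (by linarith) (by linarith) h2 h3 h1 hxx hyy
  · rw [e (Or.inl (by linear_combination x₁ * hy - y₁ * hx) :
      x₁ * y₂ - y₁ * x₂ = x₃ * y₁ - y₃ * x₁ ∨ _)]
    exact main hp1 hp2 hr₀ h₀ (by linarith) (by linarith) h3 h1 h2 hxx hyy
  · rw [e (Or.inr (by linear_combination x₁ * hy - y₁ * hx) :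
      x₁ * y₂ - y₁ * x₂ = x₁ * y₃ - y₁ * x₃ ∨ _)]
    exact main hp1 hp2 hr₀ h₀ (by linarith) (by linarith) h1 h3 h2 (by linarith) (by linarith)
  · exact absurd hyy (hsame h3 h1 h2 (by linarith) (by linarith) hxx)

lemma exists_unit_triangle {q : Seminorm ℝ (ℝ × ℝ)} (hq : Continuous q)
    (hq0 : ∀ v, q v = 0 → v = 0) {A : ℝ × ℝ} (hA : q A = 1) : ∃ C, q C = 1 ∧ q (C - A) = 1 := by
  let γ : ℝ → ℝ × ℝ := fun θ => (cos θ * A.1 - sin θ * A.2, cos θ * A.2 + sin θ * A.1)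
  have hγ : Continuous γ := by fun_prop
  have hγ0 : ∀ θ, q (γ θ) ≠ 0 := by
    intro θ h
    have h' := hq0 _ h
    have h1 : cos θ * A.1 - sin θ * A.2 = 0 := congrArg Prod.fst h'
    have h2 : cos θ * A.2 + sin θ * A.1 = 0 := congrArg Prod.snd h'
    have hA0 : A = 0 := by
      refine Prod.ext (?_ : A.1 = 0) (?_ : A.2 = 0)
      · linear_combination cos θ * h1 + sin θ * h2 - A.1 * sin_sq_add_cos_sq θ
      · linear_combination cos θ * h2 - sin θ * h1 - A.2 * sin_sq_add_cos_sq θ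
    rw [hA0, map_zero] at hA
    exact zero_ne_one hA
  have hunit : ∀ θ, q ((q (γ θ))⁻¹ • γ θ) = 1 := by
    intro θ
    rw [map_smul_eq_mul, norm_inv, norm_of_nonneg (apply_nonneg q _), inv_mul_cancel₀ (hγ0 θ)]
  have hf : Continuous fun θ => q ((q (γ θ))⁻¹ • γ θ - A) :=
    hq.comp ((((hq.comp hγ).inv₀ hγ0).smul hγ).sub continuous_const)
  have hγ_zero : γ 0 = A := by simp [γ]
  have hγ_pi : γ π = -A := by
    ext <;> simp [γ]
  obtain ⟨θ, -, hθ⟩ := intermediate_value_Icc pi_pos.le hf.continuousOn (show (1 : ℝ) ∈ _ by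
    simp only [hγ_zero, hγ_pi, map_neg_eq_map, hA, inv_one, one_smul, sub_self, map_zero]
    refine ⟨zero_le_one, ?_⟩
    rw [show -A - A = (-2 : ℝ) • A by rw [neg_smul, two_smul]; abel, map_smul_eq_mul, hA]
    norm_num)
  exact ⟨_, hunit θ, hθ⟩

lemma det2_ge_of_shortest_unit {q : Seminorm ℝ (ℝ × ℝ)} (hq : Continuous q)
    (hq0 : ∀ v, q v = 0 → v = 0) {D : ℝ} (hD : 0 < D)
    (htri : ∀ A C, q A = 1 → q C = 1 → q (C - A) = 1 → D ≤ |det2 A C|) {A B : ℝ × ℝ}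
    (hA : q A = 1)
    (hmin : ∀ i j : ℤ, j ≠ 0 → 1 ≤ q ((i : ℝ) • A + (j : ℝ) • B)) : D ≤ |det2 A B| := by
  obtain ⟨C, hC, hCA⟩ := exists_unit_triangle hq hq0 hA
  have hDC := htri A C hA hC hCA
  by_contra! hlt
  have hAC : det2 A C ≠ 0 := abs_pos.1 (hD.trans_le hDC)
  have hrep : ∃ ε : ℤ, ∃ t s : ℝ, ε ≠ 0 ∧ 0 ≤ t ∧ t < 1 ∧ (ε : ℝ) • B = t • C + s • A := by
    have hB : B = (det2 A B / det2 A C) • C + (det2 B C / det2 A C) • A := by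
      ext <;> simp only [Prod.fst_add, Prod.snd_add, Prod.smul_fst, Prod.smul_snd, smul_eq_mul] <;>
        field_simp <;> simp only [det2] <;> ring
    have ht : |det2 A B / det2 A C| < 1 := by
      rw [abs_div, div_lt_one (abs_pos.2 hAC)]
      exact hlt.trans_le hDC
    generalize det2 A B / det2 A C = t at *
    rcases le_total 0 t with h | h
    · exact ⟨1, t, _, one_ne_zero, h, (abs_lt.1 ht).2, by rw [Int.cast_one, one_smul]; exact hB⟩
    · refine ⟨-1, -t, -(det2 B C / det2 A C), by norm_num, by linarith,
        by linarith [(abs_lt.1 ht).1], ?_⟩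
      rw [Int.cast_neg, Int.cast_one, neg_smul, one_smul, neg_smul, neg_smul, ← neg_add, ← hB]
  obtain ⟨ε, t, s, hε, ht0, ht1, hB⟩ := hrep
  have h1 := hmin (-⌊s + t⌋) ε hε
  have hfl := Int.floor_le (s + t)
  have hfl' := Int.lt_floor_add_one (s + t)
  rw [hB] at h1
  push_cast at h1
  generalize (⌊s + t⌋ : ℝ) = k at *
  rcases le_total 0 (s - k) with h | h
  · have e : -k • A + (t • C + s • A) = t • C + (s - k) • A := by
      rw [neg_smul, sub_smul]; abel
    have := map_add_le_add q (t • C) ((s - k) • A)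
    rw [← e, map_smul_eq_mul, map_smul_eq_mul, hC, hA, norm_of_nonneg ht0, norm_of_nonneg h] at this
    linarith
  · have e : -k • A + (t • C + s • A) = (t + (s - k)) • C + (k - s) • (C - A) := by
      rw [neg_smul, smul_sub, add_smul, sub_smul, sub_smul, sub_smul]; abel
    have := map_add_le_add q ((t + (s - k)) • C) ((k - s) • (C - A))
    rw [← e, map_smul_eq_mul, map_smul_eq_mul, hC, hCA, norm_of_nonneg (by linarith),
      norm_of_nonneg (by linarith)] at this
    linarith

lemma det2_smul_add_smul (v1 v2 : ℝ × ℝ) (a b c d : ℝ) :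
    det2 (a • v1 + b • v2) (c • v1 + d • v2) = (a * d - b * c) * det2 v1 v2 := by
  simp only [det2, Prod.fst_add, Prod.snd_add, Prod.smul_fst, Prod.smul_snd, smul_eq_mul]
  ring

lemma exists_shortest {q : ℝ × ℝ → ℝ} (hq : ∀ v, |v.1| ≤ q v ∧ |v.2| ≤ q v) {v1 v2 : ℝ × ℝ}
    (hdet : det2 v1 v2 ≠ 0) :
    ∃ x : ℤ × ℤ, x ≠ 0 ∧ ∀ y : ℤ × ℤ, y ≠ 0 →
      q ((x.1 : ℝ) • v1 + (x.2 : ℝ) • v2) ≤ q ((y.1 : ℝ) • v1 + (y.2 : ℝ) • v2) := by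
  let f : ℤ × ℤ → ℝ := fun x => q ((x.1 : ℝ) • v1 + (x.2 : ℝ) • v2)
  have hdet2 : ∀ v w : ℝ × ℝ, |det2 v w| ≤ q v * (|w.1| + |w.2|) := by
    intro v w
    have := mul_le_mul_of_nonneg_right (hq v).1 (abs_nonneg w.2)
    have := mul_le_mul_of_nonneg_right (hq v).2 (abs_nonneg w.1)
    rw [det2]
    refine (abs_sub _ _).trans ?_
    rw [abs_mul, abs_mul]
    linarith
  have hbound : ∀ x : ℤ × ℤ, |(x.1 : ℝ)| * |det2 v1 v2| ≤ f x * (|v2.1| + |v2.2|) ∧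
      |(x.2 : ℝ)| * |det2 v1 v2| ≤ f x * (|v1.1| + |v1.2|) := by
    intro x
    have e1 := det2_smul_add_smul v1 v2 x.1 x.2 0 1
    have e2 := det2_smul_add_smul v1 v2 x.1 x.2 1 0
    simp only [zero_smul, one_smul, zero_add, add_zero, mul_zero, mul_one, sub_zero, zero_sub]
      at e1 e2
    constructor
    · rw [← abs_mul, ← e1]
      exact hdet2 _ _
    · rw [← abs_neg (x.2 : ℝ), ← abs_mul, ← e2]
      exact hdet2 _ _
  have hd : 0 < |det2 v1 v2| := abs_pos.2 hdet
  have hfin : {x : ℤ × ℤ | x ≠ 0 ∧ f x ≤ f (1, 0)}.Finite := by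
    have hint : ∀ K : ℝ, {m : ℤ | |(m : ℝ)| ≤ K}.Finite := by
      intro K
      refine (Set.finite_Icc ⌈-K⌉ ⌊K⌋).subset fun m hm => ?_
      exact ⟨Int.ceil_le.2 (abs_le.1 hm).1, Int.le_floor.2 (abs_le.1 hm).2⟩
    refine ((hint (f (1, 0) * (|v2.1| + |v2.2|) / |det2 v1 v2|)).prod
      (hint (f (1, 0) * (|v1.1| + |v1.2|) / |det2 v1 v2|))).subset fun x hx => ⟨?_, ?_⟩
    · exact (le_div_iff₀ hd).2 ((hbound x).1.trans
        (mul_le_mul_of_nonneg_right hx.2 (by positivity)))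
    · exact (le_div_iff₀ hd).2 ((hbound x).2.trans
        (mul_le_mul_of_nonneg_right hx.2 (by positivity)))
  obtain ⟨x, hx, hmin⟩ := Set.exists_min_image _ f hfin ⟨(1, 0), by simp, le_rfl⟩
  refine ⟨x, hx.1, fun y hy => ?_⟩
  rcases le_total (f y) (f (1, 0)) with h | h
  · exact hmin y ⟨hy, h⟩
  · exact hx.2.trans h

/-- Minkowski's reduction of the critical determinant to inscribed hexagons. -/
lemma det2_ge_of_triangle {q : Seminorm ℝ (ℝ × ℝ)} (hq : Continuous q)
    (hq1 : ∀ v, |v.1| ≤ q v ∧ |v.2| ≤ q v) {D : ℝ} (hD : 0 < D)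
    (htri : ∀ A C, q A = 1 → q C = 1 → q (C - A) = 1 → D ≤ |det2 A C|) {v1 v2 : ℝ × ℝ}
    (hdet : det2 v1 v2 ≠ 0)
    (hadm : ∀ x : ℤ × ℤ, x ≠ 0 → 1 ≤ q ((x.1 : ℝ) • v1 + (x.2 : ℝ) • v2)) :
    D ≤ |det2 v1 v2| := by
  have hq0 : ∀ v, q v = 0 → v = 0 := fun v hv => by
    have := hq1 v
    rw [hv] at this
    exact Prod.ext (abs_nonpos_iff.1 this.1) (abs_nonpos_iff.1 this.2)
  obtain ⟨x, hx, hmin⟩ := exists_shortest hq1 hdet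
  have hprim : ∃ m n : ℤ, IsCoprime m n ∧ ∀ y : ℤ × ℤ, y ≠ 0 →
      q ((m : ℝ) • v1 + (n : ℝ) • v2) ≤ q ((y.1 : ℝ) • v1 + (y.2 : ℝ) • v2) := by
    have hg : 0 < Int.gcd x.1 x.2 := by
      rw [Int.gcd_pos_iff]
      by_contra! h
      exact hx (Prod.ext h.1 h.2)
    obtain ⟨m, n, hmn, hm, hn⟩ := Int.exists_gcd_one hg
    refine ⟨m, n, Int.isCoprime_iff_gcd_eq_one.2 hmn, fun y hy => (le_trans ?_ (hmin y hy))⟩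
    generalize Int.gcd x.1 x.2 = g at *
    rw [hm, hn]
    push_cast
    rw [mul_comm (m : ℝ), mul_comm (n : ℝ), mul_smul, mul_smul, ← smul_add, map_smul_eq_mul,
      norm_natCast]
    exact le_mul_of_one_le_left (apply_nonneg q _) (by exact_mod_cast hg)
  obtain ⟨m, n, ⟨u, v, huv⟩, hmin⟩ := hprim
  have huv' : (u : ℝ) * m + v * n = 1 := by exact_mod_cast huv
  have hμ : 1 ≤ q ((m : ℝ) • v1 + (n : ℝ) • v2) := hadm (m, n) (by
    intro h
    obtain ⟨rfl, rfl⟩ := Prod.mk.inj h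
    simp at huv)
  have hdet' := det2_smul_add_smul v1 v2 m n (-v) u
  rw [show (m : ℝ) * u - n * -v = 1 by linear_combination huv', one_mul] at hdet'
  set A := (m : ℝ) • v1 + (n : ℝ) • v2 with hA
  set B := (-v : ℝ) • v1 + (u : ℝ) • v2 with hB
  have hμ0 : 0 < q A := by linarith
  have hunit : q ((q A)⁻¹ • A) = 1 := by
    rw [map_smul_eq_mul, norm_inv, norm_of_nonneg hμ0.le, inv_mul_cancel₀ hμ0.ne']
  have hscale : det2 ((q A)⁻¹ • A) ((q A)⁻¹ • B) = ((q A)⁻¹) ^ 2 * det2 v1 v2 := by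
    rw [← hdet']
    simp only [det2, Prod.smul_fst, Prod.smul_snd, smul_eq_mul]
    ring
  have key := det2_ge_of_shortest_unit hq hq0 hD htri hunit (fun i j hj => by
      have hne : (i * m - j * v, i * n + j * u) ≠ (0 : ℤ × ℤ) := by
        intro h
        obtain ⟨h1, h2⟩ := Prod.mk.inj h
        exact hj (by linear_combination m * h2 - n * h1 - j * huv)
      have h1 := hmin _ hne
      have e : (((i * m - j * v : ℤ) : ℝ) • v1 + ((i * n + j * u : ℤ) : ℝ) • v2)
          = (i : ℝ) • A + (j : ℝ) • B := by
        rw [hA, hB]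
        push_cast
        module
      rw [e] at h1
      rw [smul_comm (i : ℝ) (q A)⁻¹, smul_comm (j : ℝ) (q A)⁻¹, ← smul_add, map_smul_eq_mul,
        norm_inv, norm_of_nonneg hμ0.le, le_inv_mul_iff₀ hμ0, mul_one]
      exact h1)
  rw [hscale, abs_mul, abs_of_nonneg (by positivity)] at key
  refine key.trans (mul_le_of_le_one_left (abs_nonneg _) ?_)
  exact pow_le_one₀ (by positivity) (inv_le_one_of_one_le₀ hμ)

/-- If `A`, `B` and `A + B` are unit vectors, then every other nonzero integer combination of
`A` and `B` has norm at least one. -/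
lemma one_le_of_unit_triangle {q : Seminorm ℝ (ℝ × ℝ)} {A B : ℝ × ℝ} (hA : q A = 1) (hB : q B = 1)
    (hAB : q (A + B) = 1) {x : ℤ × ℤ} (hx : x ≠ 0) : 1 ≤ q ((x.1 : ℝ) • A + (x.2 : ℝ) • B) := by
  set V := (x.1 : ℝ) • A + (x.2 : ℝ) • B with hV
  have hpair : ∀ (C E : ℝ × ℝ) (a b : ℤ), q C = 1 → q E = 1 → V = (a : ℝ) • C + (b : ℝ) • E →
      1 ≤ |a| - |b| → 1 ≤ q V := by
    intro C E a b hC hE h hab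
    have hab' : (1 : ℝ) ≤ |(a : ℝ)| - |(b : ℝ)| := by exact_mod_cast hab
    have := map_sub_le_add q V ((b : ℝ) • E)
    rw [h, add_sub_cancel_right, ← h, map_smul_eq_mul, map_smul_eq_mul, hC, hE, norm_eq_abs,
      norm_eq_abs] at this
    linarith
  have hx' : ¬ (x.1 = 0 ∧ x.2 = 0) := fun h => hx (Prod.ext h.1 h.2)
  have hcases : 1 ≤ |x.1| - |x.2| ∨ 1 ≤ |x.2| - |x.1| ∨ 1 ≤ |x.1| - |x.2 - x.1| ∨
      1 ≤ |x.1 - x.2| - |x.2| := by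
    by_contra! h
    grind
  rcases hcases with h | h | h | h
  · exact hpair A B _ _ hA hB hV h
  · exact hpair B A _ _ hB hA (hV.trans (add_comm _ _)) h
  · exact hpair (A + B) B _ _ hAB hB (by rw [hV]; push_cast; module) h
  · exact hpair A (A + B) _ _ hA hAB (by rw [hV]; push_cast; module) h

/-- The `ℓ^p` norm on the plane. -/
def lpSeminorm (p : ℝ) (hp : 1 ≤ p) : Seminorm ℝ (ℝ × ℝ) :=
  Seminorm.of (fun v => (|v.1| ^ p + |v.2| ^ p) ^ (1 / p))
    (fun v w => by
      have := Real.Lp_add_le Finset.univ ![v.1, v.2] ![w.1, w.2] hp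
      simpa [Fin.sum_univ_two] using this)
    (fun a v => by
      have hp0 : 0 < p := by linarith
      simp only [Prod.smul_fst, Prod.smul_snd, smul_eq_mul, abs_mul]
      rw [mul_rpow (abs_nonneg _) (abs_nonneg _), mul_rpow (abs_nonneg _) (abs_nonneg _),
        ← mul_add, mul_rpow (by positivity) (by positivity), ← rpow_mul (abs_nonneg a),
        mul_one_div_cancel hp0.ne', rpow_one, norm_eq_abs])

lemma lpSeminorm_apply {p : ℝ} (hp : 1 ≤ p) (v : ℝ × ℝ) :
    lpSeminorm p hp v = (|v.1| ^ p + |v.2| ^ p) ^ (1 / p) := rfl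

lemma continuous_lpSeminorm {p : ℝ} (hp : 1 ≤ p) : Continuous (lpSeminorm p hp) := by
  have hp0 : 0 < p := by linarith
  exact ((continuous_fst.abs.rpow_const fun _ => Or.inr hp0.le).add
    (continuous_snd.abs.rpow_const fun _ => Or.inr hp0.le)).rpow_const
      fun _ => Or.inr (by positivity)

lemma abs_le_lpSeminorm {p : ℝ} (hp : 1 ≤ p) (v : ℝ × ℝ) :
    |v.1| ≤ lpSeminorm p hp v ∧ |v.2| ≤ lpSeminorm p hp v := by
  have hp0 : 0 < p := by linarith
  have h1 : 0 ≤ |v.1| ^ p := by positivity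
  have h2 : 0 ≤ |v.2| ^ p := by positivity
  rw [lpSeminorm_apply, one_div]
  exact ⟨(le_rpow_inv_iff_of_pos (abs_nonneg _) (by positivity) hp0).2 (by linarith),
    (le_rpow_inv_iff_of_pos (abs_nonneg _) (by positivity) hp0).2 (by linarith)⟩

lemma lpSeminorm_eq_one_iff {p : ℝ} (hp : 1 ≤ p) (v : ℝ × ℝ) :
    lpSeminorm p hp v = 1 ↔ |v.1| ^ p + |v.2| ^ p = 1 := by
  have hp0 : 0 < p := by linarith
  rw [lpSeminorm_apply, one_div, rpow_inv_eq (by positivity) zero_le_one hp0.ne', one_rpow]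

lemma one_le_lpSeminorm_iff {p : ℝ} (hp : 1 ≤ p) (v : ℝ × ℝ) :
    1 ≤ lpSeminorm p hp v ↔ v ∉ Dp p := by
  have hp0 : 0 < p := by linarith
  rw [lpSeminorm_apply, one_div, le_rpow_inv_iff_of_pos zero_le_one (by positivity) hp0, one_rpow,
    Dp, Set.mem_ofPred_eq, not_lt]

lemma isAdmissible_Dp_iff {p : ℝ} (hp : 1 ≤ p) {v1 v2 : ℝ × ℝ} (hdet : det2 v1 v2 ≠ 0) :
    IsAdmissible v1 v2 (Dp p) ↔
      ∀ x : ℤ × ℤ, x ≠ 0 → 1 ≤ lpSeminorm p hp ((x.1 : ℝ) • v1 + (x.2 : ℝ) • v2) := by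
  simp only [one_le_lpSeminorm_iff]
  refine ⟨fun h x hx hD => hx ?_, fun h y ⟨⟨m, n, hy⟩, hD⟩ => ?_⟩
  · have h0 : (x.1 : ℝ) • v1 + (x.2 : ℝ) • v2 = 0 := h ⟨⟨x.1, x.2, rfl⟩, hD⟩
    have e1 : (x.1 : ℝ) * v1.1 + x.2 * v2.1 = 0 := congrArg Prod.fst h0
    have e2 : (x.1 : ℝ) * v1.2 + x.2 * v2.2 = 0 := congrArg Prod.snd h0
    have f1 : (x.1 : ℝ) * det2 v1 v2 = 0 := by
      rw [det2]
      linear_combination v2.2 * e1 - v2.1 * e2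
    have f2 : (x.2 : ℝ) * det2 v1 v2 = 0 := by
      rw [det2]
      linear_combination v1.1 * e2 - v1.2 * e1
    exact Prod.ext (by simpa [hdet] using f1) (by simpa [hdet] using f2)
  · by_contra hne
    refine h (m, n) (fun h0 => hne ?_) (hy ▸ hD)
    obtain ⟨rfl, rfl⟩ := Prod.mk.inj h0
    simpa using hy

lemma critDet_Dp_eq {p r₀ : ℝ} (hp1 : 1 ≤ p) (hp2 : p ≤ 2) (hr₀ : r₀ ∈ Set.Icc 0 1)
    (h₀ : r₀ ^ p + (1 + r₀) ^ p = 2) :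
    critDet (Dp p) = 4 ^ (-(1 / p)) * (1 + 2 * r₀) := by
  have hp0 : 0 < p := by linarith
  have hr₀' := hr₀.1
  refine IsLeast.csInf_eq ⟨?_, ?_⟩
  · obtain ⟨b, hb, hbp⟩ : ∃ b : ℝ, 0 < b ∧ b ^ p = 1 / 2 :=
      ⟨(1 / 2) ^ p⁻¹, by positivity, rpow_inv_rpow (by norm_num) hp0.ne'⟩
    have hb2 : b ^ 2 = 4 ^ (-(1 / p)) := by
      rw [← rpow_left_inj (by positivity) (by positivity) hp0.ne', ← rpow_mul (by norm_num),
        ← rpow_two, ← rpow_mul hb.le, mul_comm 2 p, rpow_mul hb.le, hbp]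
      rw [show -(1 / p) * p = -1 by field_simp, rpow_neg_one]
      norm_num
    have hdet : det2 (r₀ * b, (1 + r₀) * b) (b, -b) = -(4 ^ (-(1 / p)) * (1 + 2 * r₀)) := by
      rw [det2, ← hb2]
      ring
    have hD : 0 < (4 : ℝ) ^ (-(1 / p)) * (1 + 2 * r₀) := by positivity
    have hdet0 : det2 (r₀ * b, (1 + r₀) * b) (b, -b) ≠ 0 := by
      rw [hdet]
      exact neg_ne_zero.2 hD.ne'
    have hunit : r₀ ^ p * b ^ p + (1 + r₀) ^ p * b ^ p = 1 := by
      rw [hbp]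
      linarith
    refine ⟨_, _, hdet0, (isAdmissible_Dp_iff hp1 hdet0).2
      fun x hx => one_le_of_unit_triangle ?_ ?_ ?_ hx, ?_⟩
    · rw [lpSeminorm_eq_one_iff, abs_of_nonneg (by positivity), abs_of_nonneg (by positivity),
        mul_rpow hr₀' hb.le, mul_rpow (by positivity) hb.le, hunit]
    · rw [lpSeminorm_eq_one_iff, abs_neg, abs_of_pos hb, hbp]
      norm_num
    · rw [lpSeminorm_eq_one_iff, Prod.mk_add_mk, show r₀ * b + b = (1 + r₀) * b by ring,
        show (1 + r₀) * b + -b = r₀ * b by ring, abs_of_nonneg (by positivity),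
        abs_of_nonneg (by positivity), mul_rpow hr₀' hb.le, mul_rpow (by positivity) hb.le,
        add_comm, hunit]
    · rw [hdet, abs_neg, abs_of_pos hD]
  · rintro _ ⟨v1, v2, hdet, hadm, rfl⟩
    refine det2_ge_of_triangle (continuous_lpSeminorm hp1) (abs_le_lpSeminorm hp1) (by positivity)
      ?_ hdet ((isAdmissible_Dp_iff hp1 hdet).1 hadm)
    intro A C hA hC hCA
    rw [lpSeminorm_eq_one_iff] at hA hC hCA
    have := triangle_det_ge (x₁ := A.1) (x₂ := -C.1) (x₃ := C.1 - A.1) (y₁ := A.2) (y₂ := -C.2)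
      (y₃ := C.2 - A.2) hp1 hp2 hr₀ h₀ (by ring) (by ring) hA (by rwa [abs_neg, abs_neg]) hCA
    rwa [show A.1 * -C.2 - A.2 * -C.1 = -det2 A C by rw [det2]; ring, abs_neg] at this

/-- For `1 ≤ p ≤ 2`, the critical determinant of `D_p` equals
`4^(-1/p) (1+τ_p)/(1-τ_p)` where `τ_p` is the unique `τ ∈ [0,1)` with `2(1-τ)^p = 1+τ^p`. -/
theorem statement1 (p τ : ℝ) (hp1 : 1 ≤ p) (hp2 : p ≤ 2)
    (hτ0 : 0 ≤ τ) (hτ1 : τ < 1) (hτeq : 2 * (1 - τ) ^ p = 1 + τ ^ p) :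
    critDet (Dp p) = (4 : ℝ) ^ (-(1 / p)) * (1 + τ) / (1 - τ) := by
  have hp0 : 0 < p := by linarith
  have h1 : 0 < 1 - τ := sub_pos.2 hτ1
  have h₀ : (τ / (1 - τ)) ^ p + (1 + τ / (1 - τ)) ^ p = 2 := by
    have hpos : 0 < (1 - τ) ^ p := by positivity
    rw [show 1 + τ / (1 - τ) = 1 / (1 - τ) by field_simp; ring, div_rpow hτ0 h1.le,
      div_rpow zero_le_one h1.le, one_rpow, ← add_div, div_eq_iff hpos.ne']
    linarith
  have hle : τ / (1 - τ) ≤ 1 := by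
    by_contra! hlt
    have := one_lt_rpow hlt hp0
    have := one_le_rpow (by linarith : 1 ≤ 1 + τ / (1 - τ)) hp0.le
    linarith
  rw [critDet_Dp_eq hp1 hp2 ⟨by positivity, hle⟩ h₀]
  field_simp
  ring
end
end

section
/- There exists a unique real number p₀ > 2 such that 4^{−1/p₀}·(1+τ_{p₀})/(1−τ_{p₀}) = (1/2)·(2^{p₀}−1)^{1/p₀}, and this p₀ satisfies 2.57 < p₀ < 2.58. -/
open Real

/-- The quantity `2^(-p)`. -/
noncomputable def decay (p : ℝ) : ℝ := 2 ^ (-p)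

/-- Half the logarithm of `4 (1 - 2^(-p))`. -/
noncomputable def halfLog (p : ℝ) : ℝ := log (4 * (1 - decay p)) / 2

/-- The number `s` with `exp (2 s) = (4 (1 - 2^(-p)))^(1/p)`; it is the inverse hyperbolic tangent
of the parameter `τ` solving the second equation. -/
noncomputable def hypArg (p : ℝ) : ℝ := halfLog p / p

/-- The logarithm of `tanh (hypArg p) ^ p`. -/
noncomputable def logTanhPow (p : ℝ) : ℝ :=
  p * (log (sinh (hypArg p)) - log (cosh (hypArg p)))

/-- The logarithm of the quotient of the two sides of the first equation, at the solution `τ` of the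
second one. -/
noncomputable def gap (p : ℝ) : ℝ :=
  p * log (cosh (hypArg p)) + log (1 + exp (logTanhPow p)) + halfLog p - log 2

/-- The derivative of `halfLog`. -/
noncomputable def halfLogDeriv (p : ℝ) : ℝ := log 2 * decay p / (2 * (1 - decay p))

/-- The second derivative of `halfLog`. -/
noncomputable def halfLogDeriv₂ (p : ℝ) : ℝ := -(log 2 ^ 2 * decay p / (2 * (1 - decay p) ^ 2))

/-- The derivative of `hypArg`. -/
noncomputable def hypArgDeriv (p : ℝ) : ℝ := (halfLogDeriv p - hypArg p) / p

/-- The derivative of `logTanhPow`. -/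
noncomputable def logTanhPowDeriv (p : ℝ) : ℝ :=
  (log (sinh (hypArg p)) - log (cosh (hypArg p))) +
    (halfLogDeriv p - hypArg p) / (sinh (hypArg p) * cosh (hypArg p))

/-- The second derivative of `logTanhPow`. -/
noncomputable def logTanhPowDeriv₂ (p : ℝ) : ℝ :=
  halfLogDeriv₂ p / (sinh (hypArg p) * cosh (hypArg p)) -
    (halfLogDeriv p - hypArg p) * hypArgDeriv p *
      (1 / sinh (hypArg p) ^ 2 + 1 / cosh (hypArg p) ^ 2)

/-- The derivative of `gap`. -/
noncomputable def gapDeriv (p : ℝ) : ℝ :=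
  log (cosh (hypArg p)) + (halfLogDeriv p - hypArg p) * (sinh (hypArg p) / cosh (hypArg p)) +
    exp (logTanhPow p) / (1 + exp (logTanhPow p)) * logTanhPowDeriv p + halfLogDeriv p

/-- The second derivative of `gap`. -/
noncomputable def gapDeriv₂ (p : ℝ) : ℝ :=
  halfLogDeriv₂ p * (sinh (hypArg p) / cosh (hypArg p)) +
    (halfLogDeriv p - hypArg p) * hypArgDeriv p / cosh (hypArg p) ^ 2 +
    (exp (logTanhPow p) / (1 + exp (logTanhPow p)) * logTanhPowDeriv₂ p +
      exp (logTanhPow p) / (1 + exp (logTanhPow p)) ^ 2 * logTanhPowDeriv p ^ 2) + halfLogDeriv₂ p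

lemma decay_pos (p : ℝ) : 0 < decay p := rpow_pos_of_pos two_pos _

lemma decay_le_quarter {p : ℝ} (hp : 2 ≤ p) : decay p ≤ 1 / 4 := by
  have h : decay p ≤ (2 : ℝ) ^ (-2 : ℝ) := rpow_le_rpow_of_exponent_le one_le_two (by linarith)
  refine h.trans_eq ?_
  rw [rpow_neg two_pos.le, rpow_two]; norm_num

lemma halfLog_pos {p : ℝ} (hp : 2 ≤ p) : 0 < halfLog p := by
  have := decay_le_quarter hp
  exact half_pos (log_pos (by linarith))

lemma hypArg_pos {p : ℝ} (hp : 2 ≤ p) : 0 < hypArg p :=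
  div_pos (halfLog_pos hp) (by linarith)

lemma sinh_hypArg_pos {p : ℝ} (hp : 2 ≤ p) : 0 < sinh (hypArg p) :=
  sinh_pos_iff.2 (hypArg_pos hp)

lemma hasDerivAt_decay (p : ℝ) : HasDerivAt decay (-(log 2 * decay p)) p := by
  have h := (hasDerivAt_neg p).const_rpow (a := 2) two_pos
  exact h.congr_deriv (by unfold decay; ring)

lemma hasDerivAt_halfLog {p : ℝ} (hp : 2 ≤ p) : HasDerivAt halfLog (halfLogDeriv p) p := by
  have hx := decay_le_quarter hp
  have hx1 : 1 - decay p ≠ 0 := by linarith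
  have h := ((((hasDerivAt_decay p).const_sub 1).const_mul 4).log
    (mul_ne_zero four_ne_zero hx1)).div_const 2
  refine h.congr_deriv ?_
  unfold halfLogDeriv
  field_simp

lemma hasDerivAt_halfLogDeriv {p : ℝ} (hp : 2 ≤ p) :
    HasDerivAt halfLogDeriv (halfLogDeriv₂ p) p := by
  have hx := decay_le_quarter hp
  have hx1 : 1 - decay p ≠ 0 := by linarith
  have h := ((hasDerivAt_decay p).const_mul (log 2)).div
    (((hasDerivAt_decay p).const_sub 1).const_mul 2) (mul_ne_zero two_ne_zero hx1)
  refine h.congr_deriv ?_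
  unfold halfLogDeriv₂
  field_simp
  ring

lemma hasDerivAt_hypArg {p : ℝ} (hp : 2 ≤ p) : HasDerivAt hypArg (hypArgDeriv p) p := by
  have hp0 : p ≠ 0 := by linarith
  refine ((hasDerivAt_halfLog hp).div (hasDerivAt_id p) hp0).congr_deriv ?_
  unfold hypArgDeriv hypArg
  simp only [id]
  field_simp

lemma hasDerivAt_log_sinh_sub_log_cosh {p : ℝ} (hp : 2 ≤ p) :
    HasDerivAt (fun q => log (sinh (hypArg q)) - log (cosh (hypArg q)))
      (hypArgDeriv p / (sinh (hypArg p) * cosh (hypArg p))) p := by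
  have hs := hasDerivAt_hypArg hp
  have hS := (sinh_hypArg_pos hp).ne'
  have hC := (cosh_pos (hypArg p)).ne'
  refine ((hs.sinh.log hS).sub (hs.cosh.log hC)).congr_deriv ?_
  have := cosh_sq (hypArg p)
  field_simp
  rw [this]; ring

lemma hasDerivAt_logTanhPow {p : ℝ} (hp : 2 ≤ p) :
    HasDerivAt logTanhPow (logTanhPowDeriv p) p := by
  have hp0 : p ≠ 0 := by linarith
  refine ((hasDerivAt_id p).mul (hasDerivAt_log_sinh_sub_log_cosh hp)).congr_deriv ?_
  unfold logTanhPowDeriv hypArgDeriv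
  simp only [id]
  field_simp

lemma hasDerivAt_logTanhPowDeriv {p : ℝ} (hp : 2 ≤ p) :
    HasDerivAt logTanhPowDeriv (logTanhPowDeriv₂ p) p := by
  have hs := hasDerivAt_hypArg hp
  have hS := (sinh_hypArg_pos hp).ne'
  have hC := (cosh_pos (hypArg p)).ne'
  refine ((hasDerivAt_log_sinh_sub_log_cosh hp).add
    (((hasDerivAt_halfLogDeriv hp).sub hs).div (hs.sinh.mul hs.cosh)
      (mul_ne_zero hS hC))).congr_deriv ?_
  unfold logTanhPowDeriv₂
  simp only [Pi.sub_apply, Pi.mul_apply]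
  field_simp
  ring

lemma hasDerivAt_gap {p : ℝ} (hp : 2 ≤ p) : HasDerivAt gap (gapDeriv p) p := by
  have hp0 : p ≠ 0 := by linarith
  have hs := hasDerivAt_hypArg hp
  have hC := (cosh_pos (hypArg p)).ne'
  have hT : 1 + exp (logTanhPow p) ≠ 0 := by positivity
  refine (((((hasDerivAt_id p).mul (hs.cosh.log hC)).add
    (((hasDerivAt_logTanhPow hp).exp.const_add 1).log hT)).add
      (hasDerivAt_halfLog hp)).sub_const (log 2)).congr_deriv ?_
  unfold gapDeriv hypArgDeriv
  simp only [id]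
  field_simp

lemma hasDerivAt_gapDeriv {p : ℝ} (hp : 2 ≤ p) : HasDerivAt gapDeriv (gapDeriv₂ p) p := by
  have hs := hasDerivAt_hypArg hp
  have hC := (cosh_pos (hypArg p)).ne'
  have hT : 1 + exp (logTanhPow p) ≠ 0 := by positivity
  have hE := (hasDerivAt_logTanhPow hp).exp
  refine ((((hs.cosh.log hC).add (((hasDerivAt_halfLogDeriv hp).sub hs).mul
    (hs.sinh.div hs.cosh hC))).add ((hE.div (hE.const_add 1) hT).mul
      (hasDerivAt_logTanhPowDeriv hp))).add (hasDerivAt_halfLogDeriv hp)).congr_deriv ?_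
  unfold gapDeriv₂
  simp only [Pi.sub_apply, Pi.div_apply]
  have hsq := cosh_sq (hypArg p)
  have h1 : (cosh (hypArg p) * hypArgDeriv p * cosh (hypArg p) -
      sinh (hypArg p) * (sinh (hypArg p) * hypArgDeriv p)) / cosh (hypArg p) ^ 2 =
      hypArgDeriv p / cosh (hypArg p) ^ 2 := by
    congr 1; linear_combination hypArgDeriv p * hsq
  rw [h1]
  field_simp
  ring

/-- The function `2^p * gap p`, which turns out to be convex on `[2, ∞)`. -/
noncomputable def weightedGap (p : ℝ) : ℝ := 2 ^ p * gap p

lemma hasDerivAt_weightedGap {p : ℝ} (hp : 2 ≤ p) :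
    HasDerivAt weightedGap (2 ^ p * (gapDeriv p + log 2 * gap p)) p := by
  have h := (hasDerivAt_id p).const_rpow (a := 2) two_pos
  exact (h.mul (hasDerivAt_gap hp)).congr_deriv (by simp only [id]; ring)

lemma hasDerivAt_weightedGapDeriv {p : ℝ} (hp : 2 ≤ p) :
    HasDerivAt (fun q => (2 : ℝ) ^ q * (gapDeriv q + log 2 * gap q))
      (2 ^ p * (gapDeriv₂ p + 2 * log 2 * gapDeriv p + log 2 ^ 2 * gap p)) p := by
  have h := (hasDerivAt_id p).const_rpow (a := 2) two_pos
  exact (h.mul ((hasDerivAt_gapDeriv hp).add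
    ((hasDerivAt_gap hp).const_mul (log 2)))).congr_deriv
      (by simp only [id, Pi.add_apply]; ring)

lemma mul_decay_le_half {p : ℝ} (hp : 2 ≤ p) : p * decay p ≤ 1 / 2 := by
  have hL := log_two_gt_d9
  have h : 2 * p ≤ (2 : ℝ) ^ p := by
    have h1 : (2 : ℝ) ^ p = 4 * exp (log 2 * (p - 2)) := by
      rw [← rpow_def_of_pos two_pos, show p = 2 + (p - 2) by ring, rpow_add two_pos, rpow_two]
      norm_num
    have h2 := add_one_le_exp (log 2 * (p - 2))
    rw [h1]
    nlinarith
  have h3 : decay p * 2 ^ p = 1 := by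
    rw [decay, ← rpow_add two_pos, neg_add_cancel, rpow_zero]
  nlinarith [decay_pos p]

lemma log_three_quarters_bounds : -0.287683 < log (3 / 4 : ℝ) ∧ log (3 / 4 : ℝ) < -0.287681 := by
  have h := abs_log_sub_add_sum_range_le (x := 1 / 4) (by norm_num [abs_of_pos]) 11
  rw [abs_of_pos (by norm_num : (0 : ℝ) < 1 / 4), abs_le] at h
  norm_num [Finset.sum_range_succ] at h
  constructor <;> linarith [h.1, h.2]

lemma log_four : log (4 : ℝ) = 2 * log 2 := by
  rw [show (4 : ℝ) = 2 ^ 2 by norm_num, log_pow]; norm_num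

lemma halfLog_eq {p : ℝ} (hp : 2 ≤ p) : halfLog p = log 2 + log (1 - decay p) / 2 := by
  have hx := decay_le_quarter hp
  rw [halfLog, log_mul four_ne_zero (by linarith), log_four]; ring

lemma le_halfLog {p : ℝ} (hp : 2 ≤ p) : 0.549305 ≤ halfLog p := by
  have hx := decay_le_quarter hp
  have h1 : log (3 / 4) ≤ log (1 - decay p) := log_le_log (by norm_num) (by linarith)
  rw [halfLog_eq hp]
  linarith [log_two_gt_d9, log_three_quarters_bounds.1]

lemma halfLog_le_log_two {p : ℝ} (hp : 2 ≤ p) : halfLog p ≤ log 2 := by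
  have hx := decay_le_quarter hp
  have h1 : log (1 - decay p) ≤ 0 := log_nonpos (by linarith) (by linarith [decay_pos p])
  rw [halfLog_eq hp]
  linarith

lemma halfLog_le_linear {p : ℝ} (hp : 2 ≤ p) : halfLog p ≤ 0.549308 + 0.115525 * (p - 2) := by
  have hx := decay_le_quarter hp
  have hL := log_two_lt_d9
  have h1 : decay p = 1 / 4 * exp (-log 2 * (p - 2)) := by
    rw [decay, neg_mul, ← mul_neg, ← rpow_def_of_pos two_pos,
      show -p = -2 + -(p - 2) by ring, rpow_add two_pos, rpow_neg two_pos.le, rpow_two]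
    norm_num
  have h2 := add_one_le_exp (-log 2 * (p - 2))
  have h3 : log (1 - decay p) ≤ log (3 / 4) + ((1 - decay p) / (3 / 4) - 1) := by
    have h4 := log_le_sub_one_of_pos (x := (1 - decay p) / (3 / 4)) (by linarith)
    rw [log_div (by linarith) (by norm_num)] at h4
    linarith
  rw [halfLog_eq hp]
  nlinarith [log_three_quarters_bounds.2]

lemma hypArg_mul {p : ℝ} (hp : 2 ≤ p) : hypArg p * p = halfLog p :=
  div_mul_cancel₀ _ (by linarith)

lemma hypArg_le {p : ℝ} (hp : 2 ≤ p) : hypArg p ≤ 0.274655 := by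
  have h := halfLog_le_linear hp
  rw [hypArg, div_le_iff₀ (by linarith)]
  linarith

lemma mul_decay_le_hypArg {p : ℝ} (hp : 2 ≤ p) : 1.0986 * decay p ≤ hypArg p := by
  have h := le_halfLog hp
  have h2 := mul_decay_le_half hp
  rw [hypArg, le_div_iff₀ (by linarith)]
  linarith

lemma halfLogDeriv_pos {p : ℝ} (hp : 2 ≤ p) : 0 < halfLogDeriv p := by
  have := decay_pos p
  have := decay_le_quarter hp
  have := log_pos one_lt_two
  exact div_pos (by positivity) (by linarith)

lemma halfLogDeriv_le {p : ℝ} (hp : 2 ≤ p) : halfLogDeriv p ≤ 0.42064 * hypArg p := by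
  have hx := decay_le_quarter hp
  have hx0 := decay_pos p
  have h2 := mul_decay_le_half hp
  have h := le_halfLog hp
  have hL := log_two_lt_d9
  have hL0 := log_two_gt_d9
  have hp0 : 0 < p := by linarith
  rw [hypArg, halfLogDeriv, mul_div_assoc', div_le_div_iff₀ (by linarith) hp0]
  have h3 : log 2 * decay p * p ≤ 0.69315 * (1 / 2) := by
    have : decay p * p ≤ 1 / 2 := by linarith
    have h0 : 0 < decay p * p := by positivity
    nlinarith
  nlinarith

lemma neg_halfLogDeriv₂_le {p : ℝ} (hp : 2 ≤ p) :
    -halfLogDeriv₂ p ≤ 0.9242 * halfLogDeriv p := by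
  have hx := decay_le_quarter hp
  have hL := log_two_lt_d9
  have h1 : 0 < 1 - decay p := by linarith
  have h : -halfLogDeriv₂ p = log 2 / (1 - decay p) * halfLogDeriv p := by
    unfold halfLogDeriv₂ halfLogDeriv; field_simp
  rw [h]
  refine mul_le_mul_of_nonneg_right ?_ (halfLogDeriv_pos hp).le
  rw [div_le_iff₀ h1]
  linarith

lemma halfLogDeriv₂_nonpos (p : ℝ) : halfLogDeriv₂ p ≤ 0 := by
  have := decay_pos p
  exact neg_nonpos.2 (by positivity)

lemma sinh_le_mul_cosh {s : ℝ} (hs : 0 ≤ s) : sinh s ≤ s * cosh s := by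
  have h1 : 0 ≤ exp (2 * s) - 1 := by linarith [add_one_le_exp (2 * s)]
  have h2 := le_log_one_add_of_nonneg h1
  rw [show 1 + (exp (2 * s) - 1) = exp (2 * s) by ring, log_exp,
    div_le_iff₀ (by linarith)] at h2
  have h3 : exp (2 * s) = exp s * exp s := by rw [← exp_add]; ring_nf
  have h4 : exp s * exp (-s) = 1 := by rw [← exp_add]; simp
  rw [sinh_eq, cosh_eq]
  have h5 : exp s * (exp s - exp (-s)) ≤ exp s * (s * (exp s + exp (-s))) := by
    nlinarith
  have h6 := le_of_mul_le_mul_left h5 (exp_pos s)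
  linarith

lemma one_add_sq_div_two_le_cosh {s : ℝ} (hs : 0 ≤ s) : 1 + s ^ 2 / 2 ≤ cosh s := by
  have h1 : cosh s = 1 + 2 * sinh (s / 2) ^ 2 := by
    have := cosh_two_mul (s / 2)
    rw [show 2 * (s / 2) = s by ring, cosh_sq] at this
    linarith
  have h2 : s / 2 ≤ sinh (s / 2) := self_le_sinh_iff.2 (by linarith)
  nlinarith

lemma sq_div_two_sub_le_log_cosh {s : ℝ} (hs : 0 ≤ s) :
    s ^ 2 / 2 - s ^ 4 / 8 ≤ log (cosh s) := by
  have h1 : log (1 + s ^ 2 / 2) ≤ log (cosh s) :=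
    log_le_log (by positivity) (one_add_sq_div_two_le_cosh hs)
  have h2 := le_log_one_add_of_nonneg (show 0 ≤ s ^ 2 / 2 by positivity)
  refine le_trans ?_ (h2.trans h1)
  rw [le_div_iff₀ (by positivity)]
  nlinarith [pow_nonneg hs 6]

lemma one_sub_sq_mul_cosh_sq_le_one {s : ℝ} (hs : 0 ≤ s) : (1 - s ^ 2) * cosh s ^ 2 ≤ 1 := by
  have h1 := sinh_le_mul_cosh hs
  have h2 : sinh s ^ 2 ≤ (s * cosh s) ^ 2 := pow_le_pow_left₀ (sinh_nonneg_iff.2 hs) h1 2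
  nlinarith [cosh_sq s]

lemma log_sinh_sub_log_cosh_le {s : ℝ} (hs : 0 < s) : log (sinh s) - log (cosh s) ≤ log s := by
  have h1 : log (sinh s) ≤ log (s * cosh s) :=
    log_le_log (sinh_pos_iff.2 hs) (sinh_le_mul_cosh hs.le)
  rw [log_mul hs.ne' (cosh_pos s).ne'] at h1
  linarith

lemma log_hypArg_le {p : ℝ} (hp : 2 ≤ p) : log (hypArg p) ≤ -1.28767 := by
  have h1 := log_le_sub_one_of_pos (x := 4 * hypArg p) (by linarith [hypArg_pos hp])
  rw [log_mul four_ne_zero (hypArg_pos hp).ne', log_four] at h1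
  linarith [hypArg_le hp, log_two_gt_d9]

lemma hypArg_le_sinh_mul_cosh {p : ℝ} (hp : 2 ≤ p) :
    hypArg p ≤ sinh (hypArg p) * cosh (hypArg p) := by
  have h1 : hypArg p ≤ sinh (hypArg p) := self_le_sinh_iff.2 (hypArg_pos hp).le
  nlinarith [one_le_cosh (hypArg p), hypArg_pos hp]

lemma logTanhPowDeriv_le {p : ℝ} (hp : 2 ≤ p) : logTanhPowDeriv p ≤ -1.8233 := by
  have hs := hypArg_pos hp
  have hs1 := hypArg_le hp
  have hS := sinh_hypArg_pos hp
  have hC := cosh_pos (hypArg p)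
  have h1 := log_sinh_sub_log_cosh_le hs
  have h2 := log_hypArg_le hp
  have h3 := halfLogDeriv_le hp
  have h4 : (halfLogDeriv p - hypArg p) / (sinh (hypArg p) * cosh (hypArg p)) ≤ -0.53565 := by
    rw [div_le_iff₀ (by positivity)]
    have h5 : sinh (hypArg p) * cosh (hypArg p) ≤ hypArg p * cosh (hypArg p) ^ 2 := by
      nlinarith [sinh_le_mul_cosh hs.le]
    have h6 : hypArg p * ((1 - hypArg p ^ 2) * cosh (hypArg p) ^ 2) ≤ hypArg p * 1 :=
      mul_le_mul_of_nonneg_left (one_sub_sq_mul_cosh_sq_le_one hs.le) hs.le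
    have h7 : 0.92456 ≤ 1 - hypArg p ^ 2 := by nlinarith
    have h8 : 0.92456 * (hypArg p * cosh (hypArg p) ^ 2) ≤
        (1 - hypArg p ^ 2) * (hypArg p * cosh (hypArg p) ^ 2) :=
      mul_le_mul_of_nonneg_right h7 (by positivity)
    linarith
  unfold logTanhPowDeriv
  linarith

lemma neg_logTanhPowDeriv₂_le {p : ℝ} (hp : 2 ≤ p) : -logTanhPowDeriv₂ p ≤ 0.5694 := by
  have hs := hypArg_pos hp
  have hs1 := hypArg_le hp
  have hp0 : 0 < p := by linarith
  have hm := halfLogDeriv_pos hp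
  have hm1 := halfLogDeriv_le hp
  set s := hypArg p with hsdef
  set r := halfLogDeriv p / s with hr
  have hrs : halfLogDeriv p = r * s := by rw [hr]; field_simp
  have hr0 : 0 < r := div_pos hm hs
  have hr1 : r ≤ 0.42064 := by rwa [hr, div_le_iff₀ hs]
  have h1 : -(halfLogDeriv₂ p / (sinh s * cosh s)) ≤ 0.9242 * r := by
    rw [← neg_div]
    calc -halfLogDeriv₂ p / (sinh s * cosh s) ≤ -halfLogDeriv₂ p / s :=
          div_le_div_of_nonneg_left (neg_nonneg.2 (halfLogDeriv₂_nonpos p)) hs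
            (hypArg_le_sinh_mul_cosh hp)
      _ ≤ 0.9242 * r := by
          rw [div_le_iff₀ hs]
          linarith [neg_halfLogDeriv₂_le hp]
  have h2 : 1 / sinh s ^ 2 + 1 / cosh s ^ 2 ≤ 1 / s ^ 2 + 1 := by
    have h3 : s ≤ sinh s := self_le_sinh_iff.2 hs.le
    refine add_le_add (one_div_le_one_div_of_le (by positivity) (by gcongr)) ?_
    exact (div_le_one (by have := cosh_pos s; positivity)).2 (one_le_pow₀ (one_le_cosh s))
  have h3 : (halfLogDeriv p - s) * hypArgDeriv p * (1 / sinh s ^ 2 + 1 / cosh s ^ 2) ≤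
      0.53772 * (1 - r) ^ 2 := by
    have h4 : (halfLogDeriv p - s) * hypArgDeriv p = (1 - r) ^ 2 * s ^ 2 / p := by
      rw [hypArgDeriv, ← hsdef, hrs]; ring
    rw [h4]
    calc (1 - r) ^ 2 * s ^ 2 / p * (1 / sinh s ^ 2 + 1 / cosh s ^ 2)
        ≤ (1 - r) ^ 2 * s ^ 2 / p * (1 / s ^ 2 + 1) := by gcongr
      _ = (1 - r) ^ 2 * ((1 + s ^ 2) / p) := by field_simp
      _ ≤ (1 - r) ^ 2 * 0.53772 := by
          gcongr
          rw [div_le_iff₀ hp0]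
          nlinarith
      _ = 0.53772 * (1 - r) ^ 2 := by ring
  unfold logTanhPowDeriv₂
  rw [← hsdef]
  nlinarith

lemma antitoneOn_logTanhPow : AntitoneOn logTanhPow (Set.Ici 2) := by
  refine antitoneOn_of_deriv_nonpos (convex_Ici 2)
    (fun p hp => (hasDerivAt_logTanhPow hp).continuousAt.continuousWithinAt) ?_ ?_ <;>
  rw [interior_Ici] <;> intro p hp <;> have hd := hasDerivAt_logTanhPow (le_of_lt hp)
  · exact hd.differentiableAt.differentiableWithinAt
  · rw [hd.deriv]
    linarith [logTanhPowDeriv_le (le_of_lt hp)]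

lemma exp_logTanhPow_le {p : ℝ} (hp : 2 ≤ p) : exp (logTanhPow p) ≤ 0.07544 := by
  have hs := hypArg_pos hp
  have hs1 := hypArg_le hp
  have h1 := log_sinh_sub_log_cosh_le hs
  have h2 := log_hypArg_le hp
  have h3 : logTanhPow p ≤ log (hypArg p ^ 2) := by
    rw [log_pow, logTanhPow]; push_cast
    nlinarith
  calc exp (logTanhPow p) ≤ exp (log (hypArg p ^ 2)) := exp_le_exp.2 h3
    _ = hypArg p ^ 2 := exp_log (by positivity)
    _ ≤ 0.07544 := by nlinarith

/-- The contribution of `log (1 + exp (logTanhPow p))` to the second derivative. -/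
lemma le_log_one_add_exp_part {p : ℝ} (hp : 2 ≤ p) :
    0.47 * (exp (logTanhPow p) / (1 + exp (logTanhPow p))) ≤
      exp (logTanhPow p) / (1 + exp (logTanhPow p)) * logTanhPowDeriv₂ p +
        exp (logTanhPow p) / (1 + exp (logTanhPow p)) ^ 2 * logTanhPowDeriv p ^ 2 +
        2 * log 2 * (exp (logTanhPow p) / (1 + exp (logTanhPow p)) * logTanhPowDeriv p) +
        log 2 ^ 2 * log (1 + exp (logTanhPow p)) := by
  have hT0 := exp_pos (logTanhPow p)
  have hT1 := exp_logTanhPow_le hp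
  have hl1 := logTanhPowDeriv_le hp
  have hl2 := neg_logTanhPowDeriv₂_le hp
  set T := exp (logTanhPow p)
  set y := logTanhPowDeriv p
  have hL0 := log_two_gt_d9
  have hL1 := log_two_lt_d9
  have h1 : T / (1 + T) ≤ log (1 + T) := by
    have h := one_sub_inv_le_log_of_pos (show 0 < 1 + T by positivity)
    convert h using 1
    field_simp
    ring
  have h2 : T / (1 + T) ^ 2 * y ^ 2 = T / (1 + T) * (1 / (1 + T) * y ^ 2) := by
    field_simp
  have h3 : 0.92985 * y ^ 2 ≤ 1 / (1 + T) * y ^ 2 := by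
    gcongr
    rw [le_div_iff₀ (by positivity)]
    linarith
  have h4 : 0.47 ≤ logTanhPowDeriv₂ p + 1 / (1 + T) * y ^ 2 + 2 * log 2 * y + log 2 ^ 2 := by
    have h5 : 0.48045 ≤ log 2 ^ 2 := by nlinarith
    have h8 : 2 * log 2 * y ≥ 1.386295 * y := by nlinarith
    nlinarith
  have h5 : T / (1 + T) * 0.47 ≤ T / (1 + T) *
      (logTanhPowDeriv₂ p + 1 / (1 + T) * y ^ 2 + 2 * log 2 * y + log 2 ^ 2) := by
    gcongr
  have h6 : log 2 ^ 2 * (T / (1 + T)) ≤ log 2 ^ 2 * log (1 + T) := by gcongr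
  rw [h2]
  linarith

lemma le_log_one_sub {x : ℝ} (h0 : 0 ≤ x) (h1 : x ≤ 1 / 4) :
    -(x + x ^ 2 / 2 + x ^ 3 / 3 + x ^ 4 / 4 + x ^ 5 / (1 - x)) ≤ log (1 - x) := by
  have h := abs_log_sub_add_sum_range_le (x := x) (by rw [abs_of_nonneg h0]; linarith) 4
  rw [abs_of_nonneg h0, abs_le] at h
  norm_num [Finset.sum_range_succ] at h
  linarith [h.1]

lemma decay_le_fifth {p : ℝ} (hp : 2.35 ≤ p) : decay p ≤ 1 / 5 := by
  have h : decay p ≤ (2 : ℝ) ^ (-(47 / 20) : ℝ) :=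
    rpow_le_rpow_of_exponent_le one_le_two (by linarith)
  refine h.trans ?_
  rw [rpow_neg two_pos.le, one_div]
  refine inv_anti₀ (by norm_num) ?_
  rw [div_eq_mul_inv, rpow_mul two_pos.le, le_rpow_inv_iff_of_pos (by norm_num) (by positivity)
    (by norm_num)]
  norm_num

/-- The contribution of `halfLog p`, together with the part of the remaining terms that is linear in
`hypArg p`. -/
lemma le_halfLog_part {p : ℝ} (hp : 2 ≤ p) {ε : ℝ} (hε0 : 0 ≤ ε)
    (hε : ε = 0.003 ∨ decay p ≤ 1 / 5) :
    -0.481 * ε ≤ (1 + hypArg p) * (halfLogDeriv₂ p + 2 * log 2 * halfLogDeriv p) +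
      log 2 ^ 2 * (halfLog p - log 2) := by
  have hx := decay_le_quarter hp
  have hx0 := decay_pos p
  have hs := mul_decay_le_hypArg hp
  have hlog := le_log_one_sub hx0.le hx
  have hm := halfLog_eq hp
  have hL : log 2 ^ 2 ≤ 0.481 := by nlinarith [log_two_lt_d9, log_two_gt_d9]
  set x := decay p with hxdef
  have hx1 : 0 < 1 - x := by linarith
  have h1 : halfLogDeriv₂ p + 2 * log 2 * halfLogDeriv p =
      log 2 ^ 2 * (x * (1 / 2 - x) / (1 - x) ^ 2) := by
    unfold halfLogDeriv₂ halfLogDeriv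
    rw [← hxdef]
    field_simp
    ring
  have h2 : -ε ≤ (1 + 1.0986 * x) * (x * (1 / 2 - x) / (1 - x) ^ 2) -
      (x + x ^ 2 / 2 + x ^ 3 / 3 + x ^ 4 / 4 + x ^ 5 / (1 - x)) / 2 := by
    have h3 : (1 + 1.0986 * x) * (x * (1 / 2 - x) / (1 - x) ^ 2) -
        (x + x ^ 2 / 2 + x ^ 3 / 3 + x ^ 4 / 4 + x ^ 5 / (1 - x)) / 2 =
        x ^ 2 * (0.2993 - (1.0986 + 1 / 6) * x - x ^ 2 / 24 - 5 / 12 * x ^ 3 + 3 / 8 * x ^ 4) /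
          (1 - x) ^ 2 := by
      field_simp
      ring
    rw [h3, le_div_iff₀ (by positivity)]
    rcases hε with rfl | hx5
    · have h4 : -0.027 ≤
          0.2993 - (1.0986 + 1 / 6) * x - x ^ 2 / 24 - 5 / 12 * x ^ 3 + 3 / 8 * x ^ 4 := by
        have : x ^ 2 ≤ 1 / 16 := by nlinarith
        have : x ^ 3 ≤ 1 / 64 := by nlinarith
        have : 0 ≤ x ^ 4 := by positivity
        linarith
      nlinarith
    · have h4 : 0 ≤
          0.2993 - (1.0986 + 1 / 6) * x - x ^ 2 / 24 - 5 / 12 * x ^ 3 + 3 / 8 * x ^ 4 := by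
        have : x ^ 2 ≤ 1 / 25 := by nlinarith
        have : x ^ 3 ≤ 1 / 125 := by nlinarith
        have : 0 ≤ x ^ 4 := by positivity
        linarith
      have h5 : 0 ≤ ε * (1 - x) ^ 2 := by positivity
      nlinarith [mul_nonneg (sq_nonneg x) h4]
  have h3 : (1 + 1.0986 * x) * (x * (1 / 2 - x) / (1 - x) ^ 2) ≤
      (1 + hypArg p) * (x * (1 / 2 - x) / (1 - x) ^ 2) := by
    refine mul_le_mul_of_nonneg_right (by linarith) (div_nonneg ?_ (by positivity))
    exact mul_nonneg hx0.le (by linarith)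
  have h4 : log 2 ^ 2 * -ε ≤ log 2 ^ 2 *
      ((1 + hypArg p) * (x * (1 / 2 - x) / (1 - x) ^ 2) + (halfLog p - log 2)) := by
    gcongr
    linarith
  rw [h1]
  have h5 : log 2 ^ 2 * ε ≤ 0.481 * ε := by gcongr
  linarith

/-- The contribution of `p * log (cosh (hypArg p))` to the second derivative. -/
lemma le_log_cosh_part {p : ℝ} (hp : 2 ≤ p) :
    hypArg p ^ 2 * (log 2 ^ 2 * p / 2 - log 2 -
        (log 2 ^ 2 * p + 2 * log 2) * hypArg p ^ 2 / 8) +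
      hypArg p * (halfLogDeriv₂ p + 2 * log 2 * halfLogDeriv p) ≤
    halfLogDeriv₂ p * (sinh (hypArg p) / cosh (hypArg p)) +
      (halfLogDeriv p - hypArg p) * hypArgDeriv p / cosh (hypArg p) ^ 2 +
      2 * log 2 * (log (cosh (hypArg p)) +
        (halfLogDeriv p - hypArg p) * (sinh (hypArg p) / cosh (hypArg p))) +
      log 2 ^ 2 * (p * log (cosh (hypArg p))) := by
  have hs := hypArg_pos hp
  have hm := halfLogDeriv_le hp
  have hc := sq_div_two_sub_le_log_cosh hs.le
  have hL := log_pos one_lt_two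
  have hp0 : 0 < p := by linarith
  have ht : sinh (hypArg p) / cosh (hypArg p) ≤ hypArg p :=
    (div_le_iff₀ (cosh_pos _)).2 (sinh_le_mul_cosh hs.le)
  have h1 : halfLogDeriv₂ p * hypArg p ≤
      halfLogDeriv₂ p * (sinh (hypArg p) / cosh (hypArg p)) :=
    mul_le_mul_of_nonpos_left ht (halfLogDeriv₂_nonpos p)
  have h2 : (halfLogDeriv p - hypArg p) * hypArg p ≤
      (halfLogDeriv p - hypArg p) * (sinh (hypArg p) / cosh (hypArg p)) :=
    mul_le_mul_of_nonpos_left ht (by linarith)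
  have h3 : 0 ≤ (halfLogDeriv p - hypArg p) * hypArgDeriv p / cosh (hypArg p) ^ 2 := by
    rw [hypArgDeriv, mul_div_assoc']
    have := mul_self_nonneg (halfLogDeriv p - hypArg p)
    positivity
  have h4 : (log 2 ^ 2 * p + 2 * log 2) * (hypArg p ^ 2 / 2 - hypArg p ^ 4 / 8) ≤
      (log 2 ^ 2 * p + 2 * log 2) * log (cosh (hypArg p)) := by gcongr
  have h5 : 2 * log 2 * ((halfLogDeriv p - hypArg p) * hypArg p) ≤ 2 * log 2 *
      ((halfLogDeriv p - hypArg p) * (sinh (hypArg p) / cosh (hypArg p))) := by gcongr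
  linarith

lemma le_weightedGapDeriv₂ {p : ℝ} (hp : 2 ≤ p) {ε : ℝ} (hε0 : 0 ≤ ε)
    (hε : ε = 0.003 ∨ decay p ≤ 1 / 5) :
    hypArg p ^ 2 * (log 2 ^ 2 * p / 2 - log 2 -
        (log 2 ^ 2 * p + 2 * log 2) * hypArg p ^ 2 / 8) - 0.481 * ε +
      0.47 * (exp (logTanhPow p) / (1 + exp (logTanhPow p))) ≤
    gapDeriv₂ p + 2 * log 2 * gapDeriv p + log 2 ^ 2 * gap p := by
  have h1 := le_halfLog_part hp hε0 hε
  have h2 := le_log_cosh_part hp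
  have h3 := le_log_one_add_exp_part hp
  unfold gapDeriv₂ gapDeriv gap
  linarith

lemma weightedGapDeriv₂_nonneg_of_three_le {p : ℝ} (hp : 3 ≤ p) :
    0 ≤ gapDeriv₂ p + 2 * log 2 * gapDeriv p + log 2 ^ 2 * gap p := by
  have hp2 : 2 ≤ p := by linarith
  refine le_trans ?_
    (le_weightedGapDeriv₂ hp2 le_rfl (Or.inr (decay_le_fifth (by linarith))))
  have hL0 := log_two_gt_d9
  have hL1 := log_two_lt_d9
  have hs := hypArg_pos hp2
  have hs1 : hypArg p ≤ 0.2311 := by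
    have := halfLog_le_log_two hp2
    rw [hypArg, div_le_iff₀ (by linarith)]
    linarith
  have hT : 0 ≤ 0.47 * (exp (logTanhPow p) / (1 + exp (logTanhPow p))) := by positivity
  have hLp : 1.4413 ≤ log 2 ^ 2 * p := by nlinarith
  have hs2 : hypArg p ^ 2 ≤ 0.0535 := by nlinarith
  have h : 0 ≤ hypArg p ^ 2 * (log 2 ^ 2 * p / 2 - log 2 -
      (log 2 ^ 2 * p + 2 * log 2) * hypArg p ^ 2 / 8) := by
    refine mul_nonneg (by positivity) ?_
    nlinarith
  linarith

lemma weightedGapDeriv₂_nonneg_of_mem_Icc {a b p s T ε : ℝ} (ha : 2 ≤ a) (hap : a ≤ p)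
    (hpb : p ≤ b) (hb : p ≤ 3) (hs : 0.549308 + 0.115525 * (a - 2) ≤ s * a) (hT0 : 0 ≤ T)
    (hT : T ≤ exp (logTanhPow b)) (hε0 : 0 ≤ ε) (hε : ε = 0.003 ∨ 2.35 ≤ a)
    (h : s ^ 2 * (0.693148 - 0.240226 * a + 0.35346 * s ^ 2) + 0.481 * ε ≤ 0.47 * (T / (1 + T)))
    (h0 : 0.240226 * a ≤ 0.693148) :
    0 ≤ gapDeriv₂ p + 2 * log 2 * gapDeriv p + log 2 ^ 2 * gap p := by
  have hp2 : 2 ≤ p := ha.trans hap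
  refine le_trans ?_ (le_weightedGapDeriv₂ hp2 hε0
    (hε.imp_right fun h35 => decay_le_fifth (h35.trans hap)))
  have hL0 := log_two_gt_d9
  have hL1 := log_two_lt_d9
  have hsp := hypArg_pos hp2
  have hss : hypArg p ≤ s := by
    have h1 := halfLog_le_linear hp2
    have h2 : 0.115525 ≤ s := by nlinarith
    rw [hypArg, div_le_iff₀ (by linarith)]
    nlinarith
  have hTp : T / (1 + T) ≤ exp (logTanhPow p) / (1 + exp (logTanhPow p)) := by
    have h1 : T ≤ exp (logTanhPow p) :=
      hT.trans (exp_le_exp.2 (antitoneOn_logTanhPow hp2 (hp2.trans hpb) hpb))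
    rw [div_le_div_iff₀ (by positivity) (by positivity)]
    linarith
  have hsq : hypArg p ^ 2 ≤ s ^ 2 := by gcongr
  have hLL0 : 0.480452 ≤ log 2 ^ 2 := by nlinarith
  have hLL1 : log 2 ^ 2 ≤ 0.480454 := by nlinarith
  have hF : -(log 2 ^ 2 * p / 2 - log 2 - (log 2 ^ 2 * p + 2 * log 2) * hypArg p ^ 2 / 8) ≤
      0.693148 - 0.240226 * a + 0.35346 * s ^ 2 := by
    have h1 : 0.480452 * a ≤ log 2 ^ 2 * p := by gcongr
    have h2 : log 2 ^ 2 * p + 2 * log 2 ≤ 2.82768 := by nlinarith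
    have h3 : (log 2 ^ 2 * p + 2 * log 2) * hypArg p ^ 2 ≤ 2.82768 * s ^ 2 := by gcongr
    linarith
  have hG : hypArg p ^ 2 *
      -(log 2 ^ 2 * p / 2 - log 2 - (log 2 ^ 2 * p + 2 * log 2) * hypArg p ^ 2 / 8) ≤
      s ^ 2 * (0.693148 - 0.240226 * a + 0.35346 * s ^ 2) :=
    (mul_le_mul_of_nonneg_left hF (sq_nonneg _)).trans
      (mul_le_mul_of_nonneg_right hsq (by nlinarith [sq_nonneg s]))
  linarith

lemma rpow_div_le_of_pow_le {y z : ℝ} {n d : ℕ} (hy : 0 ≤ y) (hz : 0 ≤ z) (hd : d ≠ 0)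
    (h : y ^ n ≤ z ^ d) : y ^ ((n : ℝ) / d) ≤ z := by
  have hd' : (0 : ℝ) < d := by positivity
  rw [div_eq_mul_inv, rpow_mul hy, rpow_inv_le_iff_of_pos (by positivity) hz hd', rpow_natCast,
    rpow_natCast]
  exact h

lemma le_rpow_div_of_pow_le {y z : ℝ} {n d : ℕ} (hy : 0 ≤ y) (hz : 0 ≤ z) (hd : d ≠ 0)
    (h : z ^ d ≤ y ^ n) : z ≤ y ^ ((n : ℝ) / d) := by
  have hd' : (0 : ℝ) < d := by positivity
  rw [div_eq_mul_inv, rpow_mul hy, le_rpow_inv_iff_of_pos hz (by positivity) hd', rpow_natCast,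
    rpow_natCast]
  exact h

lemma decay_eq_inv (p : ℝ) : decay p = (2 ^ p)⁻¹ := rpow_neg two_pos.le p

lemma decay_le_of_pow_le {x : ℝ} {n d : ℕ} (hx : 0 < x) (hd : d ≠ 0)
    (h : x⁻¹ ^ d ≤ 2 ^ n) : decay ((n : ℝ) / d) ≤ x := by
  rw [decay_eq_inv]
  exact inv_le_of_inv_le₀ hx (le_rpow_div_of_pow_le two_pos.le (by positivity) hd h)

lemma le_decay_of_pow_le {x : ℝ} {n d : ℕ} (hx : 0 < x) (hd : d ≠ 0)
    (h : 2 ^ n ≤ x⁻¹ ^ d) : x ≤ decay ((n : ℝ) / d) := by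
  rw [decay_eq_inv]
  exact le_inv_of_le_inv₀ (by positivity)
    (rpow_div_le_of_pow_le two_pos.le (by positivity) hd h)

/-- The number `(1 + τ) / (1 - τ)` determined by the second equation. -/
noncomputable def ratio (p : ℝ) : ℝ := exp (2 * hypArg p)

lemma ratio_rpow {p : ℝ} (hp : 2 ≤ p) : ratio p ^ p = 4 * (1 - decay p) := by
  have hx := decay_le_quarter hp
  rw [ratio, ← exp_mul, mul_assoc, hypArg_mul hp, halfLog, mul_div_cancel₀ _ two_ne_zero,
    exp_log (by linarith)]

lemma one_lt_ratio {p : ℝ} (hp : 2 ≤ p) : 1 < ratio p :=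
  one_lt_exp_iff.2 (by linarith [hypArg_pos hp])

lemma exp_mul_cosh (s : ℝ) : exp s * cosh s = (exp (2 * s) + 1) / 2 := by
  rw [cosh_eq, two_mul, exp_add, exp_neg]
  field_simp

lemma exp_mul_sinh (s : ℝ) : exp s * sinh s = (exp (2 * s) - 1) / 2 := by
  rw [sinh_eq, two_mul, exp_add, exp_neg]
  field_simp

lemma exp_logTanhPow {p : ℝ} (hp : 2 ≤ p) :
    exp (logTanhPow p) = ((ratio p - 1) / (ratio p + 1)) ^ p := by
  have hS := sinh_hypArg_pos hp
  have hC := cosh_pos (hypArg p)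
  have h : (ratio p - 1) / (ratio p + 1) = sinh (hypArg p) / cosh (hypArg p) := by
    rw [← mul_div_mul_left (sinh (hypArg p)) (cosh (hypArg p)) (exp_pos (hypArg p)).ne',
      exp_mul_cosh, exp_mul_sinh, div_div_div_cancel_right₀ two_ne_zero, ratio]
  rw [h, logTanhPow, ← log_div hS.ne' hC.ne', rpow_def_of_pos (div_pos hS hC), mul_comm]

lemma exp_gap {p : ℝ} (hp : 2 ≤ p) :
    exp (gap p) = (((ratio p + 1) / 2) ^ p + ((ratio p - 1) / 2) ^ p) / 2 := by
  have hu := one_lt_ratio hp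
  have hC := cosh_pos (hypArg p)
  have h1 : 0 ≤ (ratio p - 1) / (ratio p + 1) := div_nonneg (by linarith) (by linarith)
  have h2 : exp (gap p) =
      (exp (hypArg p) * cosh (hypArg p)) ^ p * (1 + exp (logTanhPow p)) / 2 := by
    rw [mul_rpow (exp_pos _).le hC.le, ← exp_mul, hypArg_mul hp, gap, exp_sub, exp_add, exp_add,
      exp_log two_pos, exp_log (by positivity), rpow_def_of_pos hC, mul_comm p]
    ring
  have h3 : (ratio p + 1) / 2 * ((ratio p - 1) / (ratio p + 1)) = (ratio p - 1) / 2 := by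
    have : ratio p + 1 ≠ 0 := by linarith
    field_simp
  rw [h2, exp_logTanhPow hp, exp_mul_cosh, ← ratio, mul_add, mul_one,
    ← mul_rpow (by linarith) h1, h3]

lemma le_ratio {y z : ℝ} {n d : ℕ} (hp : 2 ≤ (n : ℝ) / d) (hy : 0 ≤ y) (hz : 0 ≤ z)
    (hd : d ≠ 0) (h : y ^ n ≤ z ^ d) (hx : z ≤ 4 * (1 - decay ((n : ℝ) / d))) :
    y ≤ ratio ((n : ℝ) / d) := by
  rw [← rpow_le_rpow_iff hy (zero_lt_one.trans (one_lt_ratio hp)).le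
    (by linarith : 0 < (n : ℝ) / d), ratio_rpow hp]
  exact (rpow_div_le_of_pow_le hy hz hd h).trans hx

lemma ratio_le {y z : ℝ} {n d : ℕ} (hp : 2 ≤ (n : ℝ) / d) (hy : 0 ≤ y) (hz : 0 ≤ z)
    (hd : d ≠ 0) (h : z ^ d ≤ y ^ n) (hx : 4 * (1 - decay ((n : ℝ) / d)) ≤ z) :
    ratio ((n : ℝ) / d) ≤ y := by
  rw [← rpow_le_rpow_iff (zero_lt_one.trans (one_lt_ratio hp)).le hy
    (by linarith : 0 < (n : ℝ) / d), ratio_rpow hp]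
  exact hx.trans (le_rpow_div_of_pow_le hy hz hd h)

/-- A rational lower bound for `exp (logTanhPow (n / d))`, where `x` bounds `2^(-n/d)` from above and
`t` bounds the hyperbolic tangent from below. -/
lemma le_exp_logTanhPow {x t T : ℝ} {n d : ℕ} (hp : 2 ≤ (n : ℝ) / d) (hd : d ≠ 0) (hx0 : 0 < x)
    (hx1 : x ≤ 1) (ht0 : 0 ≤ t) (ht1 : t < 1) (hT : 0 ≤ T) (hx : x⁻¹ ^ d ≤ 2 ^ n)
    (ht : ((1 + t) / (1 - t)) ^ n ≤ (4 * (1 - x)) ^ d) (h : T ^ d ≤ t ^ n) :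
    T ≤ exp (logTanhPow ((n : ℝ) / d)) := by
  have hu : (1 + t) / (1 - t) ≤ ratio ((n : ℝ) / d) :=
    le_ratio hp (div_nonneg (by linarith) (by linarith)) (by linarith) hd ht
      (by linarith [decay_le_of_pow_le hx0 hd hx])
  have hu1 := one_lt_ratio hp
  have htu : t ≤ (ratio ((n : ℝ) / d) - 1) / (ratio ((n : ℝ) / d) + 1) := by
    rw [div_le_iff₀ (by linarith)] at hu
    rw [le_div_iff₀ (by linarith)]
    linarith
  rw [exp_logTanhPow hp]
  exact (le_rpow_div_of_pow_le ht0 hT hd h).trans (rpow_le_rpow ht0 htu (by linarith))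

lemma gap_two : gap 2 = 0 := by
  have h := exp_gap (le_refl 2)
  have h2 := ratio_rpow (le_refl 2)
  rw [decay_eq_inv] at h2
  simp only [rpow_two] at h h2
  rw [← exp_eq_one_iff, h]
  linarith

lemma gap_eq_zero_iff {p : ℝ} (hp : 2 ≤ p) :
    gap p = 0 ↔ ((ratio p + 1) / 2) ^ p + ((ratio p - 1) / 2) ^ p = 2 := by
  rw [← exp_eq_one_iff, exp_gap hp, div_eq_one_iff_eq two_ne_zero]

set_option exponentiation.threshold 300 in
lemma gap_neg : gap (257 / 100) < 0 := by
  have hp : (2 : ℝ) ≤ (257 : ℕ) / (100 : ℕ) := by norm_num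
  have hx : (0.16840419 : ℝ) ≤ decay ((257 : ℕ) / (100 : ℕ)) :=
    le_decay_of_pow_le (by norm_num) (by norm_num) (by norm_num)
  have hu : ratio ((257 : ℕ) / (100 : ℕ)) ≤ 1.59625422 :=
    ratio_le (z := 4 * (1 - 0.16840419)) hp (by norm_num) (by norm_num) (by norm_num)
      (by norm_num) (by linarith)
  have hu1 := one_lt_ratio hp
  have h1 : ((1.59625422 + 1) / 2 : ℝ) ^ (((257 : ℕ) : ℝ) / (100 : ℕ)) ≤ 1.95535338 :=
    rpow_div_le_of_pow_le (by norm_num) (by norm_num) (by norm_num) (by norm_num)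
  have h2 : ((1.59625422 - 1) / 2 : ℝ) ^ (((257 : ℕ) : ℝ) / (100 : ℕ)) ≤ 0.04458737 :=
    rpow_div_le_of_pow_le (by norm_num) (by norm_num) (by norm_num) (by norm_num)
  have h3 : ((ratio ((257 : ℕ) / (100 : ℕ)) + 1) / 2) ^ (((257 : ℕ) : ℝ) / (100 : ℕ)) ≤
      ((1.59625422 + 1) / 2) ^ (((257 : ℕ) : ℝ) / (100 : ℕ)) :=
    rpow_le_rpow (by linarith) (by linarith) (by linarith)
  have h4 : ((ratio ((257 : ℕ) / (100 : ℕ)) - 1) / 2) ^ (((257 : ℕ) : ℝ) / (100 : ℕ)) ≤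
      ((1.59625422 - 1) / 2) ^ (((257 : ℕ) : ℝ) / (100 : ℕ)) :=
    rpow_le_rpow (by linarith) (by linarith) (by linarith)
  have h5 : gap ((257 : ℕ) / (100 : ℕ)) < 0 := by
    rw [← exp_lt_one_iff, exp_gap hp]
    linarith [h3.trans h1, h4.trans h2]
  exact_mod_cast h5

lemma gap_pos : 0 < gap (129 / 50) := by
  have hp : (2 : ℝ) ≤ (129 : ℕ) / (50 : ℕ) := by norm_num
  have hx : decay ((129 : ℕ) / (50 : ℕ)) ≤ (0.16724095 : ℝ) :=
    decay_le_of_pow_le (by norm_num) (by norm_num) (by norm_num)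
  have hu : 1.59422691 ≤ ratio ((129 : ℕ) / (50 : ℕ)) :=
    le_ratio (z := 4 * (1 - 0.16724095)) hp (by norm_num) (by norm_num) (by norm_num)
      (by norm_num) (by linarith)
  have h1 : (1.95651484 : ℝ) ≤ ((1.59422691 + 1) / 2) ^ (((129 : ℕ) : ℝ) / (50 : ℕ)) :=
    le_rpow_div_of_pow_le (by norm_num) (by norm_num) (by norm_num) (by norm_num)
  have h2 : (0.04366561 : ℝ) ≤ ((1.59422691 - 1) / 2) ^ (((129 : ℕ) : ℝ) / (50 : ℕ)) :=
    le_rpow_div_of_pow_le (by norm_num) (by norm_num) (by norm_num) (by norm_num)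
  have h3 : ((1.59422691 + 1) / 2) ^ (((129 : ℕ) : ℝ) / (50 : ℕ)) ≤
      ((ratio ((129 : ℕ) / (50 : ℕ)) + 1) / 2) ^ (((129 : ℕ) : ℝ) / (50 : ℕ)) :=
    rpow_le_rpow (by norm_num) (by linarith) (by linarith)
  have h4 : ((1.59422691 - 1) / 2) ^ (((129 : ℕ) : ℝ) / (50 : ℕ)) ≤
      ((ratio ((129 : ℕ) / (50 : ℕ)) - 1) / 2) ^ (((129 : ℕ) : ℝ) / (50 : ℕ)) :=
    rpow_le_rpow (by norm_num) (by linarith) (by linarith)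
  have h5 : 0 < gap ((129 : ℕ) / (50 : ℕ)) := by
    rw [← one_lt_exp_iff, exp_gap hp]
    linarith [h1.trans h3, h2.trans h4]
  exact_mod_cast h5

lemma weightedGapDeriv₂_nonneg {p : ℝ} (hp : 2 ≤ p) :
    0 ≤ gapDeriv₂ p + 2 * log 2 * gapDeriv p + log 2 ^ 2 * gap p := by
  rcases le_total 3 p with h3 | h3
  · exact weightedGapDeriv₂_nonneg_of_three_le h3
  rcases le_total p (2.15) with h | ha
  · have hT : (0.05338 : ℝ) ≤ exp (logTanhPow ((43 : ℕ) / (20 : ℕ))) :=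
      le_exp_logTanhPow (x := 0.2254) (t := 0.257) (by norm_num) (by norm_num) (by norm_num)
        (by norm_num) (by norm_num) (by norm_num) (by norm_num) (by norm_num) (by norm_num)
        (by norm_num)
    refine weightedGapDeriv₂_nonneg_of_mem_Icc (s := 0.2747) (ε := 0.003) le_rfl hp
      (h.trans_eq ?_) h3 ?_ ?_ hT ?_ (.inl rfl) ?_ ?_ <;> norm_num
  rcases le_total p (2.35) with h | hb
  · have hT : (0.03612 : ℝ) ≤ exp (logTanhPow ((47 : ℕ) / (20 : ℕ))) :=
      le_exp_logTanhPow (x := 0.1962) (t := 0.2434) (by norm_num) (by norm_num) (by norm_num)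
        (by norm_num) (by norm_num) (by norm_num) (by norm_num) (by norm_num) (by norm_num)
        (by norm_num)
    refine weightedGapDeriv₂_nonneg_of_mem_Icc (s := 0.2636) (ε := 0.003) ?_ ha
      (h.trans_eq ?_) h3 ?_ ?_ hT ?_ (.inl rfl) ?_ ?_ <;> norm_num
  rcases le_total p (2.6) with h | hc
  · have hT : (0.0213 : ℝ) ≤ exp (logTanhPow ((13 : ℕ) / (5 : ℕ))) :=
      le_exp_logTanhPow (x := 0.165) (t := 0.2278) (by norm_num) (by norm_num) (by norm_num)
        (by norm_num) (by norm_num) (by norm_num) (by norm_num) (by norm_num) (by norm_num)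
        (by norm_num)
    refine weightedGapDeriv₂_nonneg_of_mem_Icc (s := 0.251) (ε := 0) ?_ hb
      (h.trans_eq ?_) h3 ?_ ?_ hT ?_ (.inr le_rfl) ?_ ?_ <;> norm_num
  rcases le_total p (2.85) with h | hd
  · have hT : (0.01228 : ℝ) ≤ exp (logTanhPow ((57 : ℕ) / (20 : ℕ))) :=
      le_exp_logTanhPow (x := 0.1387) (t := 0.2136) (by norm_num) (by norm_num) (by norm_num)
        (by norm_num) (by norm_num) (by norm_num) (by norm_num) (by norm_num) (by norm_num)
        (by norm_num)
    refine weightedGapDeriv₂_nonneg_of_mem_Icc (s := 0.238) (ε := 0) ?_ hc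
      (h.trans_eq ?_) h3 ?_ ?_ hT ?_ (.inr ?_) ?_ ?_ <;> norm_num
  · have hT : (0.0087 : ℝ) ≤ exp (logTanhPow ((3 : ℕ) / (1 : ℕ))) :=
      le_exp_logTanhPow (x := 0.125) (t := 0.2058) (by norm_num) (by norm_num) (by norm_num)
        (by norm_num) (by norm_num) (by norm_num) (by norm_num) (by norm_num) (by norm_num)
        (by norm_num)
    refine weightedGapDeriv₂_nonneg_of_mem_Icc (s := 0.2272) (ε := 0) ?_ hd
      (h3.trans_eq ?_) h3 ?_ ?_ hT ?_ (.inr ?_) ?_ ?_ <;> norm_num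

lemma convexOn_weightedGap : ConvexOn ℝ (Set.Ici 2) weightedGap := by
  refine convexOn_of_hasDerivWithinAt2_nonneg (convex_Ici 2)
    (fun p hp => (hasDerivAt_weightedGap hp).continuousAt.continuousWithinAt)
    (f' := fun q => (2 : ℝ) ^ q * (gapDeriv q + log 2 * gap q))
    (f'' := fun p => (2 : ℝ) ^ p * (gapDeriv₂ p + 2 * log 2 * gapDeriv p + log 2 ^ 2 * gap p))
    ?_ ?_ ?_ <;> rw [interior_Ici] <;> intro p hp
  · exact (hasDerivAt_weightedGap (le_of_lt hp)).hasDerivWithinAt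
  · exact (hasDerivAt_weightedGapDeriv (le_of_lt hp)).hasDerivWithinAt
  · exact mul_nonneg (rpow_pos_of_pos two_pos _).le (weightedGapDeriv₂_nonneg (le_of_lt hp))

/-- A convex function on `[a, ∞)` that vanishes at `a` and is negative at `b` is negative on
`(a, b]`. -/
lemma ConvexOn.neg_of_mem_Ioc {f : ℝ → ℝ} {a b x : ℝ} (hf : ConvexOn ℝ (Set.Ici a) f)
    (ha : f a = 0) (hb : f b < 0) (hx : x ∈ Set.Ioc a b) : f x < 0 := by
  have hab : a < b := hx.1.trans_le hx.2
  have h := hf.2 (Set.mem_Ici.2 le_rfl) (Set.mem_Ici.2 hab.le)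
    (div_nonneg (sub_nonneg.2 hx.2) (sub_pos.2 hab).le)
    (div_nonneg (sub_pos.2 hx.1).le (sub_pos.2 hab).le)
    (by rw [← add_div, div_eq_one_iff_eq (sub_pos.2 hab).ne']; ring)
  have he : ((b - x) / (b - a)) • a + ((x - a) / (b - a)) • b = x := by
    have := (sub_pos.2 hab).ne'
    simp only [smul_eq_mul]
    field_simp
    ring
  rw [he, ha, smul_zero, zero_add, smul_eq_mul] at h
  exact h.trans_lt (mul_neg_of_pos_of_neg (div_pos (sub_pos.2 hx.1) (sub_pos.2 hab)) hb)

/-- A convex function on `[a, ∞)` that vanishes at `a` and is negative somewhere is positive to the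
right of every point of `(a, ∞)` where it is nonnegative. -/
lemma ConvexOn.pos_of_nonneg_of_lt {f : ℝ → ℝ} {a b x y : ℝ} (hf : ConvexOn ℝ (Set.Ici a) f)
    (ha : f a = 0) (hab : a < b) (hb : f b < 0) (hax : a < x) (hx : 0 ≤ f x) (hxy : x < y) :
    0 < f y := by
  have hbx : b < x := by
    by_contra! h
    exact hx.not_gt (hf.neg_of_mem_Ioc ha hb ⟨hax, h⟩)
  have h := hf.2 (Set.mem_Ici.2 hab.le) (Set.mem_Ici.2 (hax.trans hxy).le)
    (div_pos (sub_pos.2 hxy) (sub_pos.2 (hbx.trans hxy))).le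
    (div_nonneg (sub_pos.2 hbx).le (sub_pos.2 (hbx.trans hxy)).le)
    (by rw [← add_div, div_eq_one_iff_eq (sub_pos.2 (hbx.trans hxy)).ne']; ring)
  have he : ((y - x) / (y - b)) • b + ((x - b) / (y - b)) • y = x := by
    have := (sub_pos.2 (hbx.trans hxy)).ne'
    simp only [smul_eq_mul]
    field_simp
    ring
  rw [he, smul_eq_mul, smul_eq_mul] at h
  have h1 : (y - x) / (y - b) * f b < 0 :=
    mul_neg_of_pos_of_neg (div_pos (sub_pos.2 hxy) (sub_pos.2 (hbx.trans hxy))) hb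
  exact pos_of_mul_pos_right (by linarith : 0 < (x - b) / (y - b) * f y)
    (div_pos (sub_pos.2 hbx) (sub_pos.2 (hbx.trans hxy))).le

lemma half_mul_rpow_eq {p : ℝ} (hp : 2 ≤ p) :
    (1 / 2) * ((2 : ℝ) ^ p - 1) ^ (1 / p) = (4 : ℝ) ^ (-(1 / p)) * ratio p := by
  have hp0 : p ≠ 0 := by linarith
  have h2 : (0 : ℝ) < 2 ^ p := rpow_pos_of_pos two_pos p
  have hx : 0 ≤ 1 - decay p := by linarith [decay_le_quarter hp]
  have h : (2 : ℝ) ^ p - 1 = (1 - decay p) * 2 ^ p := by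
    rw [decay_eq_inv]
    field_simp
  have hu : ratio p = (4 * (1 - decay p)) ^ (1 / p) := by
    rw [← ratio_rpow hp, ← rpow_mul (zero_lt_one.trans (one_lt_ratio hp)).le,
      mul_one_div_cancel hp0, rpow_one]
  rw [h, hu, mul_rpow hx h2.le, mul_rpow (by norm_num) hx, ← rpow_mul two_pos.le,
    mul_one_div_cancel hp0, rpow_one, ← mul_assoc (4 ^ (-(1 / p))), ← rpow_add four_pos,
    neg_add_cancel, rpow_zero]
  ring

lemma exists_iff_gap_eq_zero {p : ℝ} (hp : 2 < p) :
    (∃ τ : ℝ, 0 ≤ τ ∧ τ < 1 ∧ 2 * (1 - τ) ^ p = 1 + τ ^ p ∧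
      (4 : ℝ) ^ (-(1 / p)) * (1 + τ) / (1 - τ) = (1 / 2) * ((2 : ℝ) ^ p - 1) ^ (1 / p)) ↔
    gap p = 0 := by
  have h4 : (4 : ℝ) ^ (-(1 / p)) ≠ 0 := (rpow_pos_of_pos four_pos _).ne'
  have key : ∀ τ : ℝ, 0 ≤ τ → τ < 1 → (1 + τ) / (1 - τ) = ratio p →
      (2 * (1 - τ) ^ p = 1 + τ ^ p ↔ gap p = 0) := by
    intro τ h0 h1 hu
    have hc : 0 < 1 - τ := sub_pos.2 h1
    have hcp : (1 - τ) ^ p ≠ 0 := (rpow_pos_of_pos hc p).ne'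
    have e1 : (ratio p + 1) / 2 = 1 / (1 - τ) := by
      rw [← hu]; field_simp; ring
    have e2 : (ratio p - 1) / 2 = τ / (1 - τ) := by
      rw [← hu]; field_simp; ring
    rw [gap_eq_zero_iff hp.le, e1, e2, div_rpow zero_le_one hc.le, div_rpow h0 hc.le, one_rpow,
      ← add_div, div_eq_iff hcp, eq_comm]
  rw [half_mul_rpow_eq hp.le]
  simp only [mul_div_assoc, mul_right_inj' h4]
  constructor
  · rintro ⟨τ, h0, h1, h, hu⟩
    exact (key τ h0 h1 hu).1 h
  · intro h
    have hu := one_lt_ratio hp.le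
    have h0 : 0 ≤ (ratio p - 1) / (ratio p + 1) := div_nonneg (by linarith) (by linarith)
    have h1 : (ratio p - 1) / (ratio p + 1) < 1 := (div_lt_one (by linarith)).2 (by linarith)
    have hu' : (1 + (ratio p - 1) / (ratio p + 1)) / (1 - (ratio p - 1) / (ratio p + 1)) =
        ratio p := by
      rw [div_eq_iff (sub_pos.2 h1).ne']
      have : ratio p + 1 ≠ 0 := by linarith
      field_simp
      ring
    exact ⟨_, h0, h1, (key _ h0 h1 hu').2 h, hu'⟩

lemma weightedGap_two : weightedGap 2 = 0 := by rw [weightedGap, gap_two, mul_zero]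

lemma weightedGap_neg : weightedGap 2.57 < 0 := by
  rw [weightedGap, show (2.57 : ℝ) = 257 / 100 by norm_num]
  exact mul_neg_of_pos_of_neg (rpow_pos_of_pos two_pos _) gap_neg

lemma weightedGap_pos : 0 < weightedGap 2.58 := by
  rw [weightedGap, show (2.58 : ℝ) = 129 / 50 by norm_num]
  exact mul_pos (rpow_pos_of_pos two_pos _) gap_pos

lemma weightedGap_eq_zero_iff {p : ℝ} : weightedGap p = 0 ↔ gap p = 0 := by
  rw [weightedGap, mul_eq_zero, or_iff_right (rpow_pos_of_pos two_pos p).ne']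

lemma mem_Ioo_of_weightedGap_eq_zero {p : ℝ} (hp : 2 < p) (h : weightedGap p = 0) :
    2.57 < p ∧ p < 2.58 := by
  constructor <;> by_contra! hle
  · exact (convexOn_weightedGap.neg_of_mem_Ioc weightedGap_two weightedGap_neg ⟨hp, hle⟩).ne h
  · rcases hle.eq_or_lt with rfl | hlt
    · exact weightedGap_pos.ne' h
    · exact (convexOn_weightedGap.pos_of_nonneg_of_lt weightedGap_two (by norm_num)
        weightedGap_neg (by norm_num) weightedGap_pos.le hlt).ne' h

lemma eq_of_weightedGap_eq_zero {p q : ℝ} (hp : 2 < p) (hq : 2 < q) (hp0 : weightedGap p = 0)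
    (hq0 : weightedGap q = 0) : p = q := by
  have h : ∀ {a b : ℝ}, 2 < a → weightedGap a = 0 → weightedGap b = 0 → b ≤ a :=
    fun ha ha0 hb0 => not_lt.1 fun hab => (convexOn_weightedGap.pos_of_nonneg_of_lt
      weightedGap_two (by norm_num) weightedGap_neg ha ha0.ge hab).ne' hb0
  exact le_antisymm (h hq hq0 hp0) (h hp hp0 hq0)

lemma exists_weightedGap_eq_zero : ∃ p : ℝ, 2 < p ∧ weightedGap p = 0 := by
  have hc : ContinuousOn weightedGap (Set.Icc 2.57 2.58) := fun p hp =>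
    (hasDerivAt_weightedGap (by linarith [hp.1])).continuousAt.continuousWithinAt
  obtain ⟨p, hp, h⟩ := intermediate_value_Icc (by norm_num) hc
    ⟨weightedGap_neg.le, weightedGap_pos.le⟩
  exact ⟨p, by linarith [hp.1], h⟩

/-- There is a unique `p₀ > 2` with `4^(-1/p₀) (1+τ_{p₀})/(1-τ_{p₀}) = (1/2)(2^p₀ - 1)^(1/p₀)`,
and this `p₀` satisfies `2.57 < p₀ < 2.58`. -/
theorem statement2 :
    (∃! p₀ : ℝ, 2 < p₀ ∧ ∃ τ : ℝ, 0 ≤ τ ∧ τ < 1 ∧ 2 * (1 - τ) ^ p₀ = 1 + τ ^ p₀ ∧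
      (4 : ℝ) ^ (-(1 / p₀)) * (1 + τ) / (1 - τ) = (1 / 2) * ((2 : ℝ) ^ p₀ - 1) ^ (1 / p₀)) ∧
    (∀ p₀ : ℝ, 2 < p₀ →
      (∃ τ : ℝ, 0 ≤ τ ∧ τ < 1 ∧ 2 * (1 - τ) ^ p₀ = 1 + τ ^ p₀ ∧
        (4 : ℝ) ^ (-(1 / p₀)) * (1 + τ) / (1 - τ) = (1 / 2) * ((2 : ℝ) ^ p₀ - 1) ^ (1 / p₀)) →
      2.57 < p₀ ∧ p₀ < 2.58) := by
  have hiff : ∀ {p : ℝ}, 2 < p → _ := fun hp =>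
    (exists_iff_gap_eq_zero hp).trans weightedGap_eq_zero_iff.symm
  refine ⟨?_, fun p hp h => mem_Ioo_of_weightedGap_eq_zero hp ((hiff hp).1 h)⟩
  obtain ⟨p, hp, h⟩ := exists_weightedGap_eq_zero
  refine ⟨p, ⟨hp, (hiff hp).2 h⟩, ?_⟩
  rintro q ⟨hq, hq0⟩
  exact eq_of_weightedGap_eq_zero hq hp ((hiff hq).1 hq0) h
end

section
/- For every real p > 1, the infimum of the set of constants c > 0 with the property that for all real numbers α, β, γ, δ with αδ − βγ ≠ 0 there exist integers (m,n) ≠ (0,0) satisfying |αm + βn|^p + |γm + δn|^p ≤ c·|αδ − βγ|^{p/2}, equals Δ(D_p)^{−p/2}, where Δ(D_p) is the critical determinant of D_p = {(x,y) ∈ ℝ² : |x|^p + |y|^p < 1}. -/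
open Real Pointwise

noncomputable section

/-- The constants `c` for which Minkowski's Diophantine inequality with exponent `p` is solvable
for every pair of independent linear forms. -/
def minkowskiConstants (p : ℝ) : Set ℝ :=
  {c : ℝ | 0 < c ∧ ∀ α β γ δ : ℝ, α * δ - β * γ ≠ 0 →
        ∃ m n : ℤ, (m, n) ≠ (0, 0) ∧
          |α * (m : ℝ) + β * (n : ℝ)| ^ p + |γ * (m : ℝ) + δ * (n : ℝ)| ^ p
            ≤ c * |α * δ - β * γ| ^ (p / 2)}

/-- The covolumes of the lattices admissible for `S`. -/
def admissibleCovolumes (S : Set (ℝ × ℝ)) : Set ℝ :=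
  {d | ∃ v1 v2 : ℝ × ℝ, det2 v1 v2 ≠ 0 ∧ IsAdmissible v1 v2 S ∧ d = |det2 v1 v2|}

theorem bddBelow_admissibleCovolumes (S : Set (ℝ × ℝ)) : BddBelow (admissibleCovolumes S) := by
  refine ⟨0, ?_⟩
  rintro d ⟨v1, v2, -, -, rfl⟩
  exact abs_nonneg _

theorem critDet_nonneg (S : Set (ℝ × ℝ)) : 0 ≤ critDet S := by
  refine Real.sInf_nonneg ?_
  rintro d ⟨v1, v2, -, -, rfl⟩
  exact abs_nonneg _

theorem one_le_abs_intCast_rpow {p : ℝ} (hp : 0 ≤ p) {m : ℤ} (hm : m ≠ 0) :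
    1 ≤ |(m : ℝ)| ^ p :=
  Real.one_le_rpow (by exact_mod_cast Int.one_le_abs hm) hp

/-- The integer lattice is admissible for `Dp p`. -/
theorem isAdmissible_integer_lattice {p : ℝ} (hp : 0 ≤ p) :
    IsAdmissible (1, 0) (0, 1) (Dp p) := by
  rintro x ⟨⟨m, n, rfl⟩, hx⟩
  simp only [Dp, Set.mem_ofPred_eq, Prod.fst_add, Prod.snd_add, Prod.smul_fst, Prod.smul_snd,
    smul_eq_mul, mul_one, mul_zero, add_zero, zero_add] at hx
  have hm : m = 0 := by
    by_contra h
    linarith [one_le_abs_intCast_rpow hp h, Real.rpow_nonneg (abs_nonneg (n : ℝ)) p]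
  have hn : n = 0 := by
    by_contra h
    linarith [one_le_abs_intCast_rpow hp h, Real.rpow_nonneg (abs_nonneg (m : ℝ)) p]
  simp [hm, hn]

theorem admissibleCovolumes_nonempty {p : ℝ} (hp : 0 ≤ p) :
    (admissibleCovolumes (Dp p)).Nonempty :=
  ⟨_, (1, 0), (0, 1), by simp [det2], isAdmissible_integer_lattice hp, rfl⟩

/-- Independent linear forms vanish simultaneously only at the origin. -/
theorem eq_zero_of_linear_forms_eq_zero {α β γ δ : ℝ} (h : α * δ - β * γ ≠ 0) {m n : ℤ}
    (h1 : α * (m : ℝ) + β * (n : ℝ) = 0) (h2 : γ * (m : ℝ) + δ * (n : ℝ) = 0) :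
    (m, n) = (0, 0) := by
  have hm : (α * δ - β * γ) * (m : ℝ) = 0 := by linear_combination δ * h1 - β * h2
  have hn : (α * δ - β * γ) * (n : ℝ) = 0 := by linear_combination α * h2 - γ * h1
  simpa [h] using And.intro hm hn

/-- Every constant in Minkowski's inequality bounds the critical determinant from below. -/
theorem rpow_le_critDet_of_mem_minkowskiConstants {p c : ℝ} (hp : 0 < p)
    (hc : c ∈ minkowskiConstants p) : c ^ (-(2 / p)) ≤ critDet (Dp p) := by
  refine le_csInf (admissibleCovolumes_nonempty hp.le) ?_
  rintro d ⟨⟨α, γ⟩, ⟨β, δ⟩, hdet, hadm, rfl⟩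
  have hdet' : α * δ - β * γ ≠ 0 := by simpa [det2, mul_comm] using hdet
  have hd : det2 (α, γ) (β, δ) = α * δ - β * γ := by simp [det2, mul_comm]
  obtain ⟨hc0, h⟩ := hc
  obtain ⟨m, n, hmn, hle⟩ := h α β γ δ hdet'
  rw [hd]
  have hd0 : 0 < |α * δ - β * γ| := abs_pos.mpr hdet'
  set d := |α * δ - β * γ|
  have hone : 1 ≤ c * d ^ (p / 2) := by
    refine le_trans ?_ hle
    by_contra! hlt
    have hmem : ((m : ℝ) • (α, γ) + (n : ℝ) • (β, δ) : ℝ × ℝ) ∈ ({0} : Set (ℝ × ℝ)) := by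
      refine hadm ⟨⟨m, n, rfl⟩, ?_⟩
      simpa [Dp, mul_comm] using hlt
    have h0 : (m : ℝ) * α + (n : ℝ) * β = 0 ∧ (m : ℝ) * γ + (n : ℝ) * δ = 0 := by
      simpa [Prod.ext_iff] using hmem
    exact hmn (eq_zero_of_linear_forms_eq_zero hdet' (by linarith [h0.1]) (by linarith [h0.2]))
  have hinv : c⁻¹ ≤ d ^ (p / 2) := by
    rwa [inv_le_iff_one_le_mul₀' hc0]
  calc c ^ (-(2 / p)) = c⁻¹ ^ (2 / p) := by rw [Real.rpow_neg hc0.le, Real.inv_rpow hc0.le]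
    _ ≤ (d ^ (p / 2)) ^ (2 / p) :=
        Real.rpow_le_rpow (inv_nonneg.mpr hc0.le) hinv (by positivity)
    _ = d := by
        rw [← Real.rpow_mul hd0.le, show p / 2 * (2 / p) = 1 by field_simp, Real.rpow_one]

/-- A constant that fails in Minkowski's inequality bounds the critical determinant from above,
because a homothetic copy of the offending lattice is admissible. -/
theorem critDet_le_rpow_of_notMem_minkowskiConstants {p c : ℝ} (hp : 0 < p) (hc0 : 0 < c)
    (hc : c ∉ minkowskiConstants p) : critDet (Dp p) ≤ c ^ (-(2 / p)) := by
  simp only [minkowskiConstants, Set.mem_ofPred_eq, hc0, true_and] at hc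
  push Not at hc
  obtain ⟨α, β, γ, δ, hdet, h⟩ := hc
  have hd0 : 0 < |α * δ - β * γ| := abs_pos.mpr hdet
  set d := |α * δ - β * γ| with hd
  set r := c * d ^ (p / 2) with hr
  have hr0 : 0 < r := by positivity
  set t := r ^ (-(1 / p)) with ht
  have ht0 : 0 < t := by positivity
  have htp : t ^ p = r⁻¹ := by
    rw [ht, ← Real.rpow_mul hr0.le, show -(1 / p) * p = -1 by field_simp, Real.rpow_neg_one]
  have hcov : t ^ 2 * d = c ^ (-(2 / p)) := by
    rw [ht, ← Real.rpow_natCast, ← Real.rpow_mul hr0.le, hr,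
      Real.mul_rpow hc0.le (by positivity), ← Real.rpow_mul hd0.le,
      show p / 2 * (-(1 / p) * ((2 : ℕ) : ℝ)) = -1 by push_cast; field_simp,
      show -(1 / p) * ((2 : ℕ) : ℝ) = -(2 / p) by push_cast; ring,
      Real.rpow_neg_one, mul_assoc, inv_mul_cancel₀ hd0.ne', mul_one]
  have hdet2 : det2 (t * α, t * γ) (t * β, t * δ) = t ^ 2 * (α * δ - β * γ) := by
    simp only [det2]; ring
  refine csInf_le (bddBelow_admissibleCovolumes (Dp p))
    ⟨(t * α, t * γ), (t * β, t * δ), ?_, ?_, ?_⟩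
  · rw [hdet2]
    exact mul_ne_zero (by positivity) hdet
  · rintro x ⟨⟨m, n, rfl⟩, hx⟩
    by_cases hmn : (m, n) = (0, 0)
    · obtain ⟨rfl, rfl⟩ := Prod.mk.inj hmn
      simp
    · exfalso
      have hlt := h m n hmn
      simp only [Dp, Set.mem_ofPred_eq, Prod.fst_add, Prod.snd_add, Prod.smul_fst,
        Prod.smul_snd, smul_eq_mul] at hx
      rw [show (m : ℝ) * (t * α) + n * (t * β) = t * (α * m + β * n) by ring,
        show (m : ℝ) * (t * γ) + n * (t * δ) = t * (γ * m + δ * n) by ring,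
        abs_mul, abs_mul, abs_of_pos ht0, Real.mul_rpow ht0.le (abs_nonneg _),
        Real.mul_rpow ht0.le (abs_nonneg _), ← mul_add, htp, inv_mul_lt_one₀ hr0] at hx
      exact lt_asymm hx hlt
  · rw [hdet2, abs_mul, abs_of_pos (by positivity : 0 < t ^ 2), hcov]

/-- The best constant in Minkowski's Diophantine inequality: the infimum of admissible
constants `c` equals `Δ(D_p)^(-p/2)`. -/
theorem statement5 (p : ℝ) (hp : 1 < p) :
    sInf {c : ℝ | 0 < c ∧ ∀ α β γ δ : ℝ, α * δ - β * γ ≠ 0 →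
        ∃ m n : ℤ, (m, n) ≠ (0, 0) ∧
          |α * (m : ℝ) + β * (n : ℝ)| ^ p + |γ * (m : ℝ) + δ * (n : ℝ)| ^ p
            ≤ c * |α * δ - β * γ| ^ (p / 2)}
      = critDet (Dp p) ^ (-(p / 2)) := by
  change sInf (minkowskiConstants p) = _
  have hp0 : 0 < p := by linarith
  have hmul : -(2 / p) * -(p / 2) = 1 := by field_simp
  rcases (critDet_nonneg (Dp p)).eq_or_lt with h0 | hpos
  · have hempty : minkowskiConstants p = ∅ := by
      refine Set.eq_empty_of_forall_notMem fun c hc => ?_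
      have hle := rpow_le_critDet_of_mem_minkowskiConstants hp0 hc
      rw [← h0] at hle
      exact absurd hle (Real.rpow_pos_of_pos hc.1 _).not_ge
    rw [hempty, Real.sInf_empty, ← h0, Real.zero_rpow (by linarith)]
  · have hlow : ∀ c ∈ minkowskiConstants p, critDet (Dp p) ^ (-(p / 2)) ≤ c := by
      intro c hc
      have hle := Real.rpow_le_rpow_of_nonpos (Real.rpow_pos_of_pos hc.1 _)
        (rpow_le_critDet_of_mem_minkowskiConstants hp0 hc) (by linarith : -(p / 2) ≤ 0)
      rwa [← Real.rpow_mul hc.1.le, hmul, Real.rpow_one] at hle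
    have hup : ∀ c, critDet (Dp p) ^ (-(p / 2)) < c → c ∈ minkowskiConstants p := by
      intro c hlt
      have hc0 : 0 < c := (Real.rpow_pos_of_pos hpos _).trans hlt
      by_contra hc
      have hle := Real.rpow_le_rpow_of_nonpos hpos
        (critDet_le_rpow_of_notMem_minkowskiConstants hp0 hc0 hc) (by linarith : -(p / 2) ≤ 0)
      rw [← Real.rpow_mul hc0.le, hmul, Real.rpow_one] at hle
      exact hlt.not_ge hle
    refine csInf_eq_of_forall_ge_of_forall_gt_exists_lt ⟨_, hup _ (lt_add_one _)⟩ hlow ?_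
    intro w hw
    obtain ⟨c, hc, hcw⟩ := exists_between hw
    exact ⟨c, hup c hc, hcw⟩
end
end

section
/- For every real p > 1, the lattice Λ_p^{(0)} ⊆ ℝ² generated over ℤ by the vectors (1, 0) and (−1/2, σ_p/2), where σ_p = (2^p − 1)^{1/p}, is admissible for D_p = {(x,y) ∈ ℝ² : |x|^p + |y|^p < 1}, has covolume d(Λ_p^{(0)}) = σ_p/2, and the six lattice points ±(1,0), ±(−1/2, σ_p/2), ±(1/2, σ_p/2) all lie on the boundary curve |x|^p + |y|^p = 1. -/
open Real Pointwise

noncomputable section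

/-- The real number `σ_p / 2` complements `1 / 2` on the curve `|x|^p + |y|^p = 1`. -/
lemma half_rpow_add_half_sigma_rpow {p : ℝ} (hp : 1 < p) :
    (1 / 2 : ℝ) ^ p + (((2 : ℝ) ^ p - 1) ^ (1 / p) / 2) ^ p = 1 := by
  have h2 : 1 < (2 : ℝ) ^ p := Real.one_lt_rpow (by norm_num) (by linarith)
  have h0 : 0 ≤ (2 : ℝ) ^ p - 1 := by linarith
  rw [Real.div_rpow (Real.rpow_nonneg h0 _) (by norm_num), ← Real.rpow_mul h0,
    one_div_mul_cancel (by linarith), Real.rpow_one,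
    Real.div_rpow (by norm_num) (by norm_num), Real.one_rpow]
  field_simp
  ring

lemma one_le_sigma {p : ℝ} (hp : 1 < p) : 1 ≤ ((2 : ℝ) ^ p - 1) ^ (1 / p) := by
  have h2 : (2 : ℝ) ^ (1 : ℝ) ≤ (2 : ℝ) ^ p :=
    Real.rpow_le_rpow_of_exponent_le (by norm_num) hp.le
  rw [Real.rpow_one] at h2
  exact Real.one_le_rpow (by linarith) (by positivity)

lemma one_le_abs_rpow_add_abs_rpow {p s : ℝ} (hp : 0 < p) (hs : 1 ≤ s)
    (hhalf : (1 / 2 : ℝ) ^ p + (s / 2) ^ p = 1) {m n : ℤ} (hmn : m ≠ 0 ∨ n ≠ 0) :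
    1 ≤ |(m : ℝ) - n / 2| ^ p + |(n : ℝ) * (s / 2)| ^ p := by
  have hx := Real.rpow_nonneg (abs_nonneg ((m : ℝ) - n / 2)) p
  have hy := Real.rpow_nonneg (abs_nonneg ((n : ℝ) * (s / 2))) p
  rcases eq_or_ne n 0 with rfl | hn
  · have hm : (1 : ℝ) ≤ |(m : ℝ)| := by
      exact_mod_cast Int.one_le_abs (hmn.resolve_right (by simp))
    have h1 : 1 ≤ |(m : ℝ) - (0 : ℤ) / 2| ^ p :=
      Real.one_le_rpow (by simpa using hm) hp.le
    linarith
  · rw [abs_mul, abs_of_pos (show 0 < s / 2 by linarith)] at hy ⊢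
    by_cases h2 : 2 ≤ |n|
    · have h2' : (2 : ℝ) ≤ |(n : ℝ)| := by exact_mod_cast h2
      have h1 : 1 ≤ (|(n : ℝ)| * (s / 2)) ^ p :=
        Real.one_le_rpow (by nlinarith) hp.le
      linarith
    · have h1 : |n| = 1 := by
        have := Int.one_le_abs hn
        lia
      have h1' : |(n : ℝ)| = 1 := by exact_mod_cast h1
      have hodd : 1 ≤ |2 * m - n| := by
        apply Int.one_le_abs
        rcases abs_cases n with h | h <;> lia
      have hodd' : (1 : ℝ) ≤ |2 * (m : ℝ) - n| := by exact_mod_cast hodd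
      have hxhalf : 1 / 2 ≤ |(m : ℝ) - n / 2| := by
        rw [show (m : ℝ) - n / 2 = (2 * m - n) / 2 by ring, abs_div,
          abs_of_pos (show (0 : ℝ) < 2 by norm_num)]
        linarith
      have := Real.rpow_le_rpow (by norm_num) hxhalf hp.le
      rw [h1', one_mul]
      linarith

/-- The critical lattice `Λ_p^{(0)}` generated by `(1,0)` and `(-1/2, σ_p/2)` is admissible
for `D_p`, has covolume `σ_p/2`, and its six points `±(1,0), ±(-1/2,σ_p/2), ±(1/2,σ_p/2)`
lie on the boundary curve `|x|^p + |y|^p = 1`. -/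
theorem statement7 (p : ℝ) (hp : 1 < p) :
    let σ : ℝ := ((2 : ℝ) ^ p - 1) ^ (1 / p)
    let v1 : ℝ × ℝ := (1, 0)
    let v2 : ℝ × ℝ := (-(1 / 2), σ / 2)
    IsAdmissible v1 v2 (Dp p) ∧ |det2 v1 v2| = σ / 2 ∧
    v1 ∈ Cp p ∧ -v1 ∈ Cp p ∧ v2 ∈ Cp p ∧ -v2 ∈ Cp p ∧
    v1 + v2 ∈ Cp p ∧ -(v1 + v2) ∈ Cp p := by
  intro σ v1 v2
  have hp0 : 0 < p := by linarith
  have hσ : 1 ≤ σ := one_le_sigma hp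
  have hhalf : (1 / 2 : ℝ) ^ p + (σ / 2) ^ p = 1 := half_rpow_add_half_sigma_rpow hp
  have habs : |σ / 2| = σ / 2 := abs_of_pos (by linarith)
  have habs2 : |(1 / 2 : ℝ)| = 1 / 2 := abs_of_pos (by norm_num)
  have hneg : ∀ v ∈ Cp p, -v ∈ Cp p := fun v hv => by
    simpa only [Cp, Set.mem_ofPred_eq, Prod.fst_neg, Prod.snd_neg, abs_neg] using hv
  have hv1 : v1 ∈ Cp p := by
    simp [Cp, v1, Real.zero_rpow hp0.ne']
  have hv2 : v2 ∈ Cp p := by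
    change |(-(1 / 2) : ℝ)| ^ p + |σ / 2| ^ p = 1
    rwa [abs_neg, habs2, habs]
  have hv3 : v1 + v2 ∈ Cp p := by
    change |(1 + -(1 / 2) : ℝ)| ^ p + |0 + σ / 2| ^ p = 1
    rwa [zero_add, habs, show (1 + -(1 / 2) : ℝ) = 1 / 2 by norm_num, habs2]
  refine ⟨?_, ?_, hv1, hneg _ hv1, hv2, hneg _ hv2, hv3, hneg _ hv3⟩
  · rintro _ ⟨⟨m, n, rfl⟩, hD⟩
    by_contra h0
    have hmn : m ≠ 0 ∨ n ≠ 0 := by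
      by_contra! h
      exact h0 (by simp [h.1, h.2])
    refine (one_le_abs_rpow_add_abs_rpow hp0 hσ hhalf hmn).not_gt ?_
    have hD' : |(m : ℝ) * 1 + n * (-(1 / 2))| ^ p + |(m : ℝ) * 0 + n * (σ / 2)| ^ p < 1 := hD
    rwa [show (m : ℝ) * 1 + n * (-(1 / 2)) = m - n / 2 by ring, mul_zero, zero_add] at hD'
  · simp [det2, v1, v2, habs]
end
end

section
/- For every real p > 1, let τ_p be the unique τ ∈ [0,1) with 2(1−τ)^p = 1 + τ^p, and let Λ_p^{(1)} ⊆ ℝ² be the lattice generated over ℤ by v₁ = ((1+τ_p^p)^{−1/p}, τ_p(1+τ_p^p)^{−1/p}) and v₂ = (−2^{−1/p}, 2^{−1/p}). Then Λ_p^{(1)} is admissible for D_p = {(x,y) ∈ ℝ² : |x|^p + |y|^p < 1}, has covolume d(Λ_p^{(1)}) = 4^{−1/p}·(1+τ_p)/(1−τ_p), and the six lattice points ±v₁, ±v₂, ±(v₁+v₂) all lie on the boundary curve |x|^p + |y|^p = 1. -/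
open Real Pointwise

noncomputable section

/-- If `u`, `v` and `u + v` are unit vectors of a normed space, then every nonzero integer
combination of `u` and `v` has norm at least `1`. -/
theorem one_le_norm_int_combination {E : Type*} [SeminormedAddCommGroup E] [NormedSpace ℝ E]
    {u v : E} (hu : ‖u‖ = 1) (hv : ‖v‖ = 1) (huv : ‖u + v‖ = 1) {m n : ℤ}
    (hmn : ¬(m = 0 ∧ n = 0)) : 1 ≤ ‖(m : ℝ) • u + (n : ℝ) • v‖ := by
  have key : ∀ (a b : ℤ) (x y : E), ‖x‖ = 1 → ‖y‖ = 1 →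
      (m : ℝ) • u + (n : ℝ) • v = (a : ℝ) • x + (b : ℝ) • y →
      ((|a| - |b| : ℤ) : ℝ) ≤ ‖(m : ℝ) • u + (n : ℝ) • v‖ := by
    intro a b x y hx hy h
    have h1 := norm_sub_norm_le ((a : ℝ) • x) (-((b : ℝ) • y))
    rw [norm_neg, norm_smul, norm_smul, hx, hy, sub_neg_eq_add, ← h] at h1
    simpa using h1
  have h1 := key m n u v hu hv rfl
  have h2 := key n m v u hv hu (add_comm _ _)
  have h3 := key n (m - n) (u + v) u huv hu (by push_cast; module)
  have h4 := key (m - n) n u (u + v) hu huv (by push_cast; module)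
  by_contra! hlt
  have hz : ∀ k : ℤ, (k : ℝ) ≤ ‖(m : ℝ) • u + (n : ℝ) • v‖ → k < 1 := fun k hk => by
    exact_mod_cast hk.trans_lt hlt
  have g1 := hz _ h1
  have g2 := hz _ h2
  have g3 := hz _ h3
  have g4 := hz _ h4
  grind

theorem norm_toLp_eq_rpow {p : ℝ} (hp : 1 < p) (x : ℝ × ℝ) :
    ‖WithLp.toLp (ENNReal.ofReal p) x‖ = (|x.1| ^ p + |x.2| ^ p) ^ (1 / p) := by
  have h : (ENNReal.ofReal p).toReal = p := ENNReal.toReal_ofReal (by linarith)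
  rw [WithLp.prod_norm_eq_add (by rw [h]; linarith), h]
  rfl

theorem neg_mem_Cp {p : ℝ} {x : ℝ × ℝ} (hx : x ∈ Cp p) : -x ∈ Cp p := by
  simpa [Cp] using hx

theorem isAdmissible_Dp_of_mem_Cp {p : ℝ} (hp : 1 < p) {v1 v2 : ℝ × ℝ} (h1 : v1 ∈ Cp p)
    (h2 : v2 ∈ Cp p) (h12 : v1 + v2 ∈ Cp p) : IsAdmissible v1 v2 (Dp p) := by
  rintro x ⟨⟨m, n, rfl⟩, hx⟩
  by_contra hne
  have : Fact (1 ≤ ENNReal.ofReal p) := ⟨by simpa using hp.le⟩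
  have hC : ∀ y ∈ Cp p, ‖WithLp.toLp (ENNReal.ofReal p) y‖ = 1 := by
    intro y hy
    rw [norm_toLp_eq_rpow hp, show |y.1| ^ p + |y.2| ^ p = 1 from hy, one_rpow]
  have h := one_le_norm_int_combination (hC _ h1) (hC _ h2) (hC _ h12) (m := m) (n := n)
    (by rintro ⟨rfl, rfl⟩; simp at hne)
  rw [← WithLp.toLp_smul, ← WithLp.toLp_smul, ← WithLp.toLp_add, norm_toLp_eq_rpow hp] at h
  exact absurd (rpow_lt_one (by positivity) hx (by positivity)) h.not_gt

/-- The critical lattice `Λ_p^{(1)}` generated by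
`v₁ = ((1+τ_p^p)^(-1/p), τ_p (1+τ_p^p)^(-1/p))` and `v₂ = (-2^(-1/p), 2^(-1/p))`
is admissible for `D_p`, has covolume `4^(-1/p)(1+τ_p)/(1-τ_p)`, and its six points
`±v₁, ±v₂, ±(v₁+v₂)` lie on the boundary curve `|x|^p + |y|^p = 1`. -/
theorem statement8 (p τ : ℝ) (hp : 1 < p)
    (hτ0 : 0 ≤ τ) (hτ1 : τ < 1) (hτeq : 2 * (1 - τ) ^ p = 1 + τ ^ p) :
    let v1 : ℝ × ℝ := ((1 + τ ^ p) ^ (-(1 / p)), τ * (1 + τ ^ p) ^ (-(1 / p)))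
    let v2 : ℝ × ℝ := (-(2 : ℝ) ^ (-(1 / p)), (2 : ℝ) ^ (-(1 / p)))
    IsAdmissible v1 v2 (Dp p) ∧
    |det2 v1 v2| = (4 : ℝ) ^ (-(1 / p)) * (1 + τ) / (1 - τ) ∧
    v1 ∈ Cp p ∧ -v1 ∈ Cp p ∧ v2 ∈ Cp p ∧ -v2 ∈ Cp p ∧
    v1 + v2 ∈ Cp p ∧ -(v1 + v2) ∈ Cp p := by
  intro v1 v2
  have hA : 0 < 1 + τ ^ p := by positivity
  have ht : 0 < 1 - τ := by linarith
  have rpow_neg_inv : ∀ {a : ℝ}, 0 < a → (a ^ (-(1 / p))) ^ p = a⁻¹ := by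
    intro a ha
    rw [← rpow_mul ha.le, show -(1 / p) * p = -1 by field_simp, rpow_neg_one]
  set s := (1 + τ ^ p) ^ (-(1 / p)) with hs
  set c := (2 : ℝ) ^ (-(1 / p)) with hc
  have hs0 : 0 < s := by positivity
  have hc0 : 0 < c := by positivity
  have hsp : s ^ p = (1 + τ ^ p)⁻¹ := rpow_neg_inv hA
  have hcp : c ^ p = 2⁻¹ := rpow_neg_inv two_pos
  have hcs : c = s * (1 - τ) := by
    rw [hs, ← hτeq, mul_rpow two_pos.le (by positivity), ← rpow_mul ht.le,
      show p * -(1 / p) = -1 by field_simp, rpow_neg_one]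
    field_simp
    exact hc
  have hc4 : (4 : ℝ) ^ (-(1 / p)) = c * c := by
    rw [hc, ← mul_rpow two_pos.le two_pos.le]; norm_num
  have h1 : v1 ∈ Cp p := by
    change |s| ^ p + |τ * s| ^ p = 1
    rw [abs_of_pos hs0, abs_of_nonneg (by positivity), mul_rpow hτ0 hs0.le, hsp]
    field_simp
  have h2 : v2 ∈ Cp p := by
    change |-c| ^ p + |c| ^ p = 1
    rw [abs_neg, abs_of_pos hc0, hcp]
    norm_num
  have h12 : v1 + v2 ∈ Cp p := by
    change |s + -c| ^ p + |τ * s + c| ^ p = 1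
    rw [show s + -c = τ * s by rw [hcs]; ring, show τ * s + c = s by rw [hcs]; ring,
      abs_of_pos hs0, abs_of_nonneg (by positivity), mul_rpow hτ0 hs0.le, hsp]
    field_simp
    ring
  refine ⟨isAdmissible_Dp_of_mem_Cp hp h1 h2 h12, ?_, h1, neg_mem_Cp h1, h2, neg_mem_Cp h2, h12,
    neg_mem_Cp h12⟩
  have hdet : det2 v1 v2 = s * c * (1 + τ) := by
    change s * c - τ * s * -c = _
    ring
  rw [hdet, abs_of_nonneg (by positivity), hc4, eq_div_iff ht.ne', hcs]
  ring
end
end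

section
/- The critical determinant of the open unit disc D_2 = {(x,y) ∈ ℝ² : x² + y² < 1} equals √3/2, and the lattice Λ_2^{(0)} generated over ℤ by (1, 0) and (1/2, √3/2) is admissible for D_2 with covolume √3/2, i.e. Λ_2^{(0)} is a critical lattice for D_2. -/
open Real Pointwise

noncomputable section

/-- The open unit disc `D_2 = {(x,y) : x² + y² < 1}`. -/
def D2 : Set (ℝ × ℝ) := {xy | xy.1 ^ 2 + xy.2 ^ 2 < 1}

/-- A real binary quadratic form that is at least `1` at every nonzero integer point has
determinant at least `3/4`. -/
theorem three_quarters_le_of_one_le_form (a b c : ℝ)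
    (h : ∀ m n : ℤ, (m ≠ 0 ∨ n ≠ 0) → 1 ≤ a * m ^ 2 + 2 * b * m * n + c * n ^ 2) :
    3 / 4 ≤ a * c - b ^ 2 := by
  obtain ⟨N, hN⟩ := exists_nat_ge a
  induction N generalizing a b c with
  | zero =>
    have h1 := h 1 0 (by simp)
    norm_num at h1 hN
    linarith
  | succ N ih =>
    by_contra! hlt
    have ha : 1 ≤ a := by simpa using h 1 0 (by simp)
    set k : ℤ := round (b / a) with hk
    set b' : ℝ := b - k * a with hb'
    set c' : ℝ := c - 2 * k * b + k ^ 2 * a with hc'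
    have hdet : c' * a - b' ^ 2 = a * c - b ^ 2 := by rw [hb', hc']; ring
    have hform : ∀ m n : ℤ, (m ≠ 0 ∨ n ≠ 0) →
        1 ≤ c' * m ^ 2 + 2 * b' * m * n + a * n ^ 2 := by
      intro m n hmn
      have h1 := h (n - k * m) m (by
        by_contra! h0
        obtain ⟨h0, rfl⟩ := h0
        simp_all)
      push_cast at h1
      rw [hb', hc']
      linarith
    have hc1 : 1 ≤ c' := by simpa using hform 1 0 (by simp)
    have hb2 : b' ^ 2 ≤ a ^ 2 / 4 := by
      have h1 : |b / a - k| ≤ 1 / 2 := abs_sub_round (b / a)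
      have h2 : b' = (b / a - k) * a := by rw [hb']; field_simp
      have h3 : (b / a - k) ^ 2 ≤ (1 / 2) ^ 2 := sq_le_sq' (by linarith [abs_le.1 h1])
        (abs_le.1 h1).2
      rw [h2, mul_pow]
      nlinarith [sq_nonneg a]
    have hac : a * c' < 3 / 4 + a ^ 2 / 4 := by linarith
    have ha3 : 3 ≤ a := by
      by_contra! h3
      nlinarith
    have hcN : c' ≤ N := by
      push_cast at hN
      nlinarith
    linarith [ih c' b' a hform hcN]

theorem sqrt_three_div_two_le_abs_det2 {v1 v2 : ℝ × ℝ} (hdet : det2 v1 v2 ≠ 0)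
    (hadm : IsAdmissible v1 v2 D2) : √3 / 2 ≤ |det2 v1 v2| := by
  obtain ⟨x, y⟩ := v1
  obtain ⟨z, w⟩ := v2
  simp only [det2] at hdet ⊢
  have h := three_quarters_le_of_one_le_form (x ^ 2 + y ^ 2) (x * z + y * w) (z ^ 2 + w ^ 2) (by
    intro m n hmn
    by_contra! hlt
    have h0 := hadm ⟨⟨m, n, rfl⟩, show (m * x + n * z) ^ 2 + (m * y + n * w) ^ 2 < 1 by linarith⟩
    have h1 : m * x + n * z = 0 := congrArg Prod.fst h0
    have h2 : m * y + n * w = 0 := congrArg Prod.snd h0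
    have hm : (m : ℝ) * (x * w - y * z) = 0 := by linear_combination w * h1 - z * h2
    have hn : (n : ℝ) * (x * w - y * z) = 0 := by linear_combination x * h2 - y * h1
    simp_all)
  refine (pow_le_pow_iff_left₀ (by positivity) (abs_nonneg _) two_ne_zero).1 ?_
  rw [sq_abs, div_pow, Real.sq_sqrt (by norm_num)]
  linarith

theorem isAdmissible_hexagonal : IsAdmissible (1, 0) (1 / 2, √3 / 2) D2 := by
  rintro v ⟨⟨m, n, rfl⟩, hv⟩
  have h3 : √3 ^ 2 = 3 := Real.sq_sqrt (by norm_num)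
  have hlt : (m * 1 + n * (1 / 2) : ℝ) ^ 2 + (m * 0 + n * (√3 / 2)) ^ 2 < 1 := hv
  have hlt' : m ^ 2 + m * n + n ^ 2 < 1 := by
    have : (m ^ 2 + m * n + n ^ 2 : ℝ) < 1 := by linear_combination hlt - n ^ 2 / 4 * h3
    exact_mod_cast this
  have hn : n = 0 := by
    by_contra h
    nlinarith [sq_nonneg (2 * m + n), Int.one_le_abs h, sq_abs n]
  subst hn
  have hm : m = 0 := by
    by_contra h
    nlinarith [Int.one_le_abs h, sq_abs m]
  simp [hm]

/-- `Δ(D_2) = √3/2`, and the hexagonal lattice generated by `(1,0)` and `(1/2, √3/2)` is a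
critical lattice for `D_2`: it is admissible with covolume `√3/2`. -/
theorem statement13 :
    critDet D2 = Real.sqrt 3 / 2 ∧
    IsAdmissible (1, 0) (1 / 2, Real.sqrt 3 / 2) D2 ∧
    |det2 ((1 : ℝ), (0 : ℝ)) ((1 / 2 : ℝ), Real.sqrt 3 / 2)| = Real.sqrt 3 / 2 := by
  have hcov : |det2 ((1 : ℝ), (0 : ℝ)) ((1 / 2 : ℝ), √3 / 2)| = √3 / 2 := by
    rw [det2, abs_of_nonneg] <;> norm_num
    positivity
  refine ⟨IsLeast.csInf_eq ⟨⟨_, _, ?_, isAdmissible_hexagonal, hcov.symm⟩, ?_⟩,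
    isAdmissible_hexagonal, hcov⟩
  · simp [det2]
  · rintro d ⟨v1, v2, hdet, hadm, rfl⟩
    exact sqrt_three_div_two_le_abs_det2 hdet hadm
end
end
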